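/- For every n ≥ 509 one has exp(2/p_n) · (1 + 1.1253/(log p_n · log log N_n)) < ζ(6), and consequently R_6(N_n) < e^γ, where R_6(x) := Ψ_6(x)/(x log log x). -/

import Mathlib

open Finset Filter

/-- Generalized Dedekind psi function `Ψ_t(n) = n ∏_{p ∣ n} (1 + 1/p + ⋯ + 1/p^(t-1))`. -/
noncomputable def Psi (t n : ℕ) : ℝ :=
  (n : ℝ) * ∏ p ∈ n.primeFactors, ∑ i ∈ Finset.range t, (1 : ℝ) / (p : ℝ) ^ i

/-- The primorial `N_n = ∏_{k=1}^n p_k`, the product of the first `n` primes. -/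
noncomputable def primorialAt (n : ℕ) : ℕ := ∏ k ∈ Finset.range n, Nat.nth Nat.Prime k

/-- The `n`-th prime `p_n` (so `nthPrime 1 = 2`). -/
noncomputable def nthPrime (n : ℕ) : ℕ := Nat.nth Nat.Prime (n - 1)

/-- The ratio `R_t(x) = Ψ_t(x) / (x log log x)`. -/
noncomputable def Rt (t n : ℕ) : ℝ := Psi t n / ((n : ℝ) * Real.log (Real.log n))

/-- The Riemann zeta value `ζ(t) = ∑_{n ≥ 1} n^{-t}` at an integer argument. -/
noncomputable def zetaNat (t : ℕ) : ℝ := ∑' k : ℕ, 1 / ((k : ℝ) + 1) ^ t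

theorem sub_le_mul_log_sub {a b : ℝ} (ha : 0 < a) (hb : 0 < b) :
    b - a ≤ b * (Real.log b - Real.log a) := by
  have h := Real.log_le_sub_one_of_pos (div_pos ha hb)
  rw [Real.log_div ha.ne' hb.ne'] at h
  have : b * (Real.log a - Real.log b) ≤ b * (a / b - 1) := mul_le_mul_of_nonneg_left h hb.le
  have e : b * (a / b - 1) = a - b := by field_simp
  linarith

theorem mul_log_sub_le_sub {a b : ℝ} (ha : 0 < a) (hb : 0 < b) :
    a * (Real.log b - Real.log a) ≤ b - a := by
  have := sub_le_mul_log_sub hb ha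
  linarith

theorem log_factorial_bounds (n : ℕ) (hn : 1 ≤ n) :
    (n : ℝ) * Real.log n - n + 1 ≤ Real.log (n.factorial) ∧
      Real.log (n.factorial) ≤ n * Real.log n - n + 1 + Real.log n := by
  induction n, hn using Nat.le_induction with
  | base => simp
  | succ n hn ih =>
    have hn0 : (0 : ℝ) < n := by exact_mod_cast hn
    have h1 : (0 : ℝ) < (n : ℝ) + 1 := by positivity
    rw [Nat.factorial_succ, Nat.cast_mul, Real.log_mul (by positivity) (by positivity)]
    push_cast
    have u := sub_le_mul_log_sub hn0 h1
    have v := mul_log_sub_le_sub hn0 h1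
    constructor <;> nlinarith [ih.1, ih.2]

theorem log_floor_factorial_bounds {x : ℝ} (hx : 1 ≤ x) :
    x * Real.log x - x - Real.log x - 1 ≤ Real.log (⌊x⌋₊.factorial) ∧
      Real.log (⌊x⌋₊.factorial) ≤ x * Real.log x - x + Real.log x + 1 := by
  have hn : 1 ≤ ⌊x⌋₊ := by rwa [Nat.one_le_floor_iff]
  obtain ⟨h1, h2⟩ := log_factorial_bounds _ hn
  have hf := Nat.floor_le (show 0 ≤ x by linarith)
  have hf' := Nat.lt_floor_add_one x
  set n : ℝ := (⌊x⌋₊ : ℝ)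
  have hn' : (1 : ℝ) ≤ n := by simpa [n] using (by exact_mod_cast hn : (1 : ℝ) ≤ (⌊x⌋₊ : ℝ))
  have hl0 : 0 ≤ Real.log n := Real.log_nonneg hn'
  have hl : Real.log n ≤ Real.log x := Real.log_le_log (by linarith) hf
  have u := sub_le_mul_log_sub (show 0 < n by linarith) (show 0 < x by linarith)
  have v := mul_log_sub_le_sub (show 0 < n by linarith) (show 0 < x by linarith)
  constructor <;> nlinarith

theorem sum_vonMangoldt_mul_div (N : ℕ) :
    ∑ d ∈ Ioc 0 N, ArithmeticFunction.vonMangoldt d * ((N / d : ℕ) : ℝ) =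
      Real.log (N.factorial) := by
  rw [← ArithmeticFunction.sum_Ioc_mul_zeta_eq_sum, ArithmeticFunction.vonMangoldt_mul_zeta]
  induction N with
  | zero => simp
  | succ n ih =>
    rw [← Finset.insert_Ioc_right_eq_Ioc_add_one (Nat.zero_le n), Finset.sum_insert (by simp), ih,
      Nat.factorial_succ, Nat.cast_mul, Real.log_mul (by positivity) (by positivity)]
    simp

theorem sum_vonMangoldt_mul_div_div (N j : ℕ) :
    ∑ d ∈ Ioc 0 N, ArithmeticFunction.vonMangoldt d * ((N / d / j : ℕ) : ℝ) =
      Real.log ((N / j).factorial) := by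
  rw [← sum_vonMangoldt_mul_div (N / j)]
  symm
  have hsub : Ioc 0 (N / j) ⊆ Ioc 0 N := Ioc_subset_Ioc le_rfl (Nat.div_le_self _ _)
  rw [← sum_subset hsub]
  · refine sum_congr rfl fun d _ => ?_
    rw [Nat.div_div_eq_div_mul, Nat.div_div_eq_div_mul, mul_comm j d]
  · intro d hd hd'
    simp only [mem_Ioc, not_and, not_le] at hd hd'
    have h := hd' hd.1
    have : N / d / j = 0 := by
      rw [Nat.div_div_eq_div_mul, mul_comm, ← Nat.div_div_eq_div_mul]
      exact Nat.div_eq_of_lt h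
    simp [this]

theorem psi_nat (N : ℕ) : Chebyshev.psi N = ∑ d ∈ Ioc 0 N, ArithmeticFunction.vonMangoldt d := by
  simp [Chebyshev.psi]

theorem chebyshev_factor (m : ℕ) :
    m / 2 + m / 3 + m / 5 ≤ m + m / 30 ∧ m + m / 30 ≤ m / 2 + m / 3 + m / 5 + 1 ∧
      (1 ≤ m → m < 6 → m + m / 30 = m / 2 + m / 3 + m / 5 + 1) := by
  obtain ⟨q, r, hr, rfl⟩ : ∃ q r, r < 30 ∧ m = 30 * q + r :=
    ⟨m / 30, m % 30, Nat.mod_lt _ (by norm_num), (Nat.div_add_mod m 30).symm⟩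
  refine ⟨?_, ?_, ?_⟩
  · interval_cases r <;> omega
  · interval_cases r <;> omega
  · intros; interval_cases r <;> omega

theorem chebyshev_comb (N : ℕ) :
    Real.log (N.factorial) + Real.log ((N / 30).factorial) - Real.log ((N / 2).factorial)
      - Real.log ((N / 3).factorial) - Real.log ((N / 5).factorial) =
    ∑ d ∈ Ioc 0 N, ArithmeticFunction.vonMangoldt d *
      (((N / d : ℕ) : ℝ) + ((N / d / 30 : ℕ) : ℝ) - ((N / d / 2 : ℕ) : ℝ)
        - ((N / d / 3 : ℕ) : ℝ) - ((N / d / 5 : ℕ) : ℝ)) := by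
  rw [← sum_vonMangoldt_mul_div, ← sum_vonMangoldt_mul_div_div N 30,
    ← sum_vonMangoldt_mul_div_div N 2,
    ← sum_vonMangoldt_mul_div_div N 3,
    ← sum_vonMangoldt_mul_div_div N 5, ← sum_add_distrib, ← sum_sub_distrib,
    ← sum_sub_distrib, ← sum_sub_distrib]
  exact sum_congr rfl fun d _ => by ring

theorem chebyshev_comb_le_psi (N : ℕ) :
    Real.log (N.factorial) + Real.log ((N / 30).factorial) - Real.log ((N / 2).factorial)
      - Real.log ((N / 3).factorial) - Real.log ((N / 5).factorial) ≤ Chebyshev.psi N := by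
  rw [chebyshev_comb, psi_nat]
  refine sum_le_sum fun d _ => ?_
  have h := (chebyshev_factor (N / d)).2.1
  have h' : ((N / d : ℕ) : ℝ) + ((N / d / 30 : ℕ) : ℝ) ≤ ((N / d / 2 : ℕ) : ℝ) +
    ((N / d / 3 : ℕ) : ℝ) + ((N / d / 5 : ℕ) : ℝ) + 1 := by exact_mod_cast h
  have := ArithmeticFunction.vonMangoldt_nonneg (n := d)
  nlinarith

theorem psi_sub_psi_le_chebyshev_comb (N : ℕ) :
    Chebyshev.psi N - Chebyshev.psi ((N / 6 : ℕ) : ℝ) ≤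
    Real.log (N.factorial) + Real.log ((N / 30).factorial) - Real.log ((N / 2).factorial)
      - Real.log ((N / 3).factorial) - Real.log ((N / 5).factorial) := by
  rw [chebyshev_comb, psi_nat, psi_nat]
  have hsub : Ioc 0 (N / 6) ⊆ Ioc 0 N := Ioc_subset_Ioc le_rfl (Nat.div_le_self _ _)
  rw [← sum_sdiff hsub, add_sub_cancel_right]
  rw [← sum_sdiff (f := fun d => ArithmeticFunction.vonMangoldt d *
      (((N / d : ℕ) : ℝ) + ((N / d / 30 : ℕ) : ℝ) - ((N / d / 2 : ℕ) : ℝ)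
        - ((N / d / 3 : ℕ) : ℝ) - ((N / d / 5 : ℕ) : ℝ))) hsub]
  have h2 : 0 ≤ ∑ d ∈ Ioc 0 (N / 6), ArithmeticFunction.vonMangoldt d *
      (((N / d : ℕ) : ℝ) + ((N / d / 30 : ℕ) : ℝ) - ((N / d / 2 : ℕ) : ℝ)
        - ((N / d / 3 : ℕ) : ℝ) - ((N / d / 5 : ℕ) : ℝ)) := by
    refine sum_nonneg fun d _ => mul_nonneg ArithmeticFunction.vonMangoldt_nonneg ?_
    have h := (chebyshev_factor (N / d)).1
    have h' : ((N / d / 2 : ℕ) : ℝ) + ((N / d / 3 : ℕ) : ℝ) + ((N / d / 5 : ℕ) : ℝ) ≤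
      ((N / d : ℕ) : ℝ) + ((N / d / 30 : ℕ) : ℝ) := by exact_mod_cast h
    linarith
  have h1 : ∑ d ∈ Ioc 0 N \ Ioc 0 (N / 6), ArithmeticFunction.vonMangoldt d ≤
      ∑ d ∈ Ioc 0 N \ Ioc 0 (N / 6), ArithmeticFunction.vonMangoldt d *
      (((N / d : ℕ) : ℝ) + ((N / d / 30 : ℕ) : ℝ) - ((N / d / 2 : ℕ) : ℝ)
        - ((N / d / 3 : ℕ) : ℝ) - ((N / d / 5 : ℕ) : ℝ)) := by
    refine sum_le_sum fun d hd => ?_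
    simp only [Finset.mem_sdiff, mem_Ioc, not_and, not_le] at hd
    obtain ⟨⟨hd0, hdN⟩, hd2⟩ := hd
    have hlt : N / d < 6 := by
      have := hd2 hd0
      rw [Nat.div_lt_iff_lt_mul (by norm_num)] at this
      rw [Nat.div_lt_iff_lt_mul hd0]; linarith
    have hge : 1 ≤ N / d := (Nat.one_le_div_iff hd0).2 hdN
    have h := (chebyshev_factor (N / d)).2.2 hge hlt
    have h' : ((N / d : ℕ) : ℝ) + ((N / d / 30 : ℕ) : ℝ) = ((N / d / 2 : ℕ) : ℝ) +
      ((N / d / 3 : ℕ) : ℝ) + ((N / d / 5 : ℕ) : ℝ) + 1 := by exact_mod_cast h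
    have e : ((N / d : ℕ) : ℝ) + ((N / d / 30 : ℕ) : ℝ) - ((N / d / 2 : ℕ) : ℝ)
        - ((N / d / 3 : ℕ) : ℝ) - ((N / d / 5 : ℕ) : ℝ) = 1 := by linarith
    rw [e, mul_one]
  linarith

theorem log_div_factorial_bounds (N j : ℕ) (hj : 0 < j) (hN : j ≤ N) :
    (N : ℝ) / j * (Real.log N - Real.log j) - (N : ℝ) / j - Real.log N - 1 ≤
        Real.log ((N / j).factorial) ∧
      Real.log ((N / j).factorial) ≤
        (N : ℝ) / j * (Real.log N - Real.log j) - (N : ℝ) / j + Real.log N + 1 := by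
  have hj0 : (0 : ℝ) < j := by exact_mod_cast hj
  have hjN : (j : ℝ) ≤ N := by exact_mod_cast hN
  have hx : 1 ≤ (N : ℝ) / j := by rwa [one_le_div hj0]
  have h := log_floor_factorial_bounds hx
  rw [Nat.floor_div_natCast, Nat.floor_natCast, Real.log_div (by linarith) hj0.ne'] at h
  have : 0 ≤ Real.log (j : ℝ) := Real.log_natCast_nonneg j
  constructor <;> linarith [h.1, h.2]

theorem chebyshev_comb_bounds (N : ℕ) (hN : 30 ≤ N) :
    |Real.log (N.factorial) + Real.log ((N / 30).factorial) - Real.log ((N / 2).factorial)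
      - Real.log ((N / 3).factorial) - Real.log ((N / 5).factorial) -
      N * (Real.log 2 / 2 + Real.log 3 / 3 + Real.log 5 / 5 -
        (Real.log 2 + Real.log 3 + Real.log 5) / 30)| ≤ 5 * Real.log N + 5 := by
  have h1 := log_div_factorial_bounds N 1 (by norm_num) (by omega)
  have h30 := log_div_factorial_bounds N 30 (by norm_num) (by omega)
  have h2 := log_div_factorial_bounds N 2 (by norm_num) (by omega)
  have h3 := log_div_factorial_bounds N 3 (by norm_num) (by omega)
  have h5 := log_div_factorial_bounds N 5 (by norm_num) (by omega)
  have e : Real.log 30 = Real.log 2 + Real.log 3 + Real.log 5 := by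
    rw [← Real.log_mul (by norm_num) (by norm_num), ← Real.log_mul (by norm_num) (by norm_num)]
    norm_num
  simp only [Nat.div_one, Nat.cast_one, Real.log_one, div_one, Nat.cast_ofNat, e] at h1 h2 h3 h5 h30
  rw [abs_le]
  constructor <;> linarith [h1.1, h1.2, h2.1, h2.2, h3.1, h3.2, h5.1, h5.2, h30.1, h30.2]

theorem chebyshev_const_bounds :
    0.92129 ≤ Real.log 2 / 2 + Real.log 3 / 3 + Real.log 5 / 5 -
        (Real.log 2 + Real.log 3 + Real.log 5) / 30 ∧
    Real.log 2 / 2 + Real.log 3 / 3 + Real.log 5 / 5 -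
        (Real.log 2 + Real.log 3 + Real.log 5) / 30 ≤ 0.9213 := by
  have := Real.log_two_gt_d9
  have := Real.log_two_lt_d9
  have := Real.log_three_gt_d9
  have := Real.log_three_lt_d9
  have := Real.log_five_gt_d9
  have := Real.log_five_lt_d9
  constructor <;> linarith

theorem psi_ge_chebyshev (N : ℕ) (hN : 30 ≤ N) :
    0.92129 * (N : ℝ) - (5 * Real.log N + 5) ≤ Chebyshev.psi N := by
  have h := chebyshev_comb_le_psi N
  have h' := (abs_le.1 (chebyshev_comb_bounds N hN)).1
  have hc := chebyshev_const_bounds.1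
  have : (0 : ℝ) ≤ N := by positivity
  nlinarith

theorem psi_sub_psi_le_chebyshev (N : ℕ) (hN : 30 ≤ N) :
    Chebyshev.psi N - Chebyshev.psi ((N / 6 : ℕ) : ℝ) ≤ 0.9213 * (N : ℝ) + (5 * Real.log N + 5) := by
  have h := psi_sub_psi_le_chebyshev_comb N
  have h' := (abs_le.1 (chebyshev_comb_bounds N hN)).2
  have hc := chebyshev_const_bounds.2
  have : (0 : ℝ) ≤ N := by positivity
  nlinarith

theorem log_div_self_le {a x c : ℝ} (ha : Real.exp 1 ≤ a) (hx : a ≤ x)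
    (hc : Real.log a ≤ c * a) : Real.log x ≤ c * x := by
  have ha0 : 0 < a := lt_of_lt_of_le (Real.exp_pos 1) ha
  have h := Real.log_div_self_antitoneOn (show a ∈ {x | Real.exp 1 ≤ x} from ha)
    (show x ∈ {x | Real.exp 1 ≤ x} from ha.trans hx) hx
  have h2 : Real.log a / a ≤ c := by rwa [div_le_iff₀ ha0]
  have := h.trans h2
  rwa [div_le_iff₀ (by linarith)] at this

theorem psi_bounds {x : ℝ} (hx : 65669 ≤ x) :
    0.9203 * x ≤ Chebyshev.psi x ∧ Chebyshev.psi x ≤ 1.1127 * x := by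
  have hx0 : 0 ≤ x := by linarith
  set N := ⌊x⌋₊ with hNdef
  have hN : 65669 ≤ N := Nat.le_floor (by exact_mod_cast hx)
  have hNx : (N : ℝ) ≤ x := Nat.floor_le hx0
  have hNx' : x < N + 1 := Nat.lt_floor_add_one x
  have hN' : (65669 : ℝ) ≤ N := by exact_mod_cast hN
  have hlogN : Real.log N ≤ 0.000170 * N := by
    refine log_div_self_le (a := 65669) (by linarith [Real.exp_one_lt_d9]) hN' ?_
    rw [show (0.000170 : ℝ) * 65669 = 11.16373 by norm_num]
    have h1 : Real.log (65669 : ℝ) ≤ Real.log ((2 : ℝ) ^ 16 * (1 + 133 / 65536)) :=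
      Real.log_le_log (by norm_num) (by norm_num)
    rw [Real.log_mul (by norm_num) (by norm_num), Real.log_pow] at h1
    have := Real.log_le_sub_one_of_pos (show (0 : ℝ) < 1 + 133 / 65536 by norm_num)
    have := Real.log_two_lt_d9
    push_cast at h1
    linarith
  rw [Chebyshev.psi_eq_psi_coe_floor, ← hNdef]
  constructor
  · have := psi_ge_chebyshev N (by omega)
    linarith
  · have step : ∀ M : ℕ, 30 ≤ M → M ≤ N → Chebyshev.psi M ≤
        Chebyshev.psi ((M / 6 : ℕ) : ℝ) + 0.9213 * (M : ℝ) + (5 * Real.log N + 5) := by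
      intro M hM hMN
      have := psi_sub_psi_le_chebyshev M hM
      have : Real.log M ≤ Real.log N := Real.log_le_log (by exact_mod_cast (by omega : 0 < M))
        (by exact_mod_cast hMN)
      linarith
    have s0 := step N (by omega) le_rfl
    have s1 := step (N / 6) (by omega) (by omega)
    have s2 := step (N / 6 / 6) (by omega) (by omega)
    have s3 := step (N / 6 / 6 / 6) (by omega) (by omega)
    have s4 := Chebyshev.psi_le_const_mul_self (x := ((N / 6 / 6 / 6 / 6 : ℕ) : ℝ)) (by positivity)
    have h4 : Real.log 4 = 2 * Real.log 2 := by
      rw [show (4 : ℝ) = 2 ^ 2 by norm_num, Real.log_pow]; norm_num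
    have d1 : ((N / 6 : ℕ) : ℝ) ≤ N / 6 := by
      simpa using (Nat.cast_div_le (α := ℝ) (m := N) (n := 6))
    have d2 : ((N / 6 / 6 : ℕ) : ℝ) ≤ ((N / 6 : ℕ) : ℝ) / 6 := by
      simpa using (Nat.cast_div_le (α := ℝ) (m := N / 6) (n := 6))
    have d3 : ((N / 6 / 6 / 6 : ℕ) : ℝ) ≤ ((N / 6 / 6 : ℕ) : ℝ) / 6 := by
      simpa using (Nat.cast_div_le (α := ℝ) (m := N / 6 / 6) (n := 6))
    have d4 : ((N / 6 / 6 / 6 / 6 : ℕ) : ℝ) ≤ ((N / 6 / 6 / 6 : ℕ) : ℝ) / 6 := by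
      simpa using (Nat.cast_div_le (α := ℝ) (m := N / 6 / 6 / 6) (n := 6))
    have := Real.log_two_lt_d9
    have p4 : (Real.log 4 + 4) * ((N / 6 / 6 / 6 / 6 : ℕ) : ℝ) ≤
        5.3863 * ((N / 6 / 6 / 6 / 6 : ℕ) : ℝ) := by
      refine mul_le_mul_of_nonneg_right ?_ (by positivity)
      rw [h4]; linarith
    linarith

/-- The `m`-th harmonic number, as a real number. -/
noncomputable def harm (m : ℕ) : ℝ := ∑ k ∈ Ioc 0 m, (1 : ℝ) / k

/-- The sum of `log n / n` over `1 ≤ n ≤ N`. -/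
noncomputable def sumLogDiv (N : ℕ) : ℝ := ∑ n ∈ Ioc 0 N, Real.log n / n

/-- The sum of `Λ(n) / n` over `1 ≤ n ≤ N`. -/
noncomputable def sumMangoldtDiv (N : ℕ) : ℝ :=
  ∑ d ∈ Ioc 0 N, ArithmeticFunction.vonMangoldt d / d

theorem sum_Ioc_zero_succ (f : ℕ → ℝ) (n : ℕ) :
    ∑ k ∈ Ioc 0 (n + 1), f k = ∑ k ∈ Ioc 0 n, f k + f (n + 1) :=
  Finset.sum_Ioc_succ_top (Nat.zero_le n) f

theorem harm_zero : harm 0 = 0 := by simp [harm]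

theorem harm_succ (m : ℕ) : harm (m + 1) = harm m + 1 / ((m : ℝ) + 1) := by
  simp [harm, sum_Ioc_zero_succ]

theorem sum_vonMangoldt_div_mul_harm (N : ℕ) :
    ∑ d ∈ Ioc 0 N, ArithmeticFunction.vonMangoldt d / d * harm (N / d) = sumLogDiv N := by
  let f : ArithmeticFunction ℝ := ⟨fun n => ArithmeticFunction.vonMangoldt n / n, by simp⟩
  let g : ArithmeticFunction ℝ := ⟨fun n => 1 / n, by simp⟩
  have h := ArithmeticFunction.sum_Ioc_mul_eq_sum_sum f g N
  have e : ∀ n ∈ Ioc 0 N, (f * g) n = Real.log n / n := by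
    intro n hn
    rw [mem_Ioc] at hn
    rw [ArithmeticFunction.mul_apply, ← ArithmeticFunction.vonMangoldt_sum,
      Nat.sum_divisorsAntidiagonal (fun a b => f a * g b), sum_div]
    refine sum_congr rfl fun i hi => ?_
    have hi' := Nat.dvd_of_mem_divisors hi
    have hi0 : (i : ℝ) ≠ 0 := by
      exact_mod_cast (Nat.pos_of_dvd_of_pos hi' hn.1).ne'
    have hn0 : (n : ℝ) ≠ 0 := by exact_mod_cast hn.1.ne'
    change ArithmeticFunction.vonMangoldt i / i * (1 / ((n / i : ℕ) : ℝ)) = _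
    rw [Nat.cast_div hi' hi0]
    field_simp
  rw [sum_congr rfl e] at h
  exact h.symm

theorem sum_vonMangoldt_div_mul_harm_div (N j : ℕ) :
    ∑ d ∈ Ioc 0 N, ArithmeticFunction.vonMangoldt d / d * harm (N / d / j) =
      sumLogDiv (N / j) := by
  rw [← sum_vonMangoldt_div_mul_harm (N / j)]
  symm
  have hsub : Ioc 0 (N / j) ⊆ Ioc 0 N := Ioc_subset_Ioc le_rfl (Nat.div_le_self _ _)
  rw [← sum_subset hsub]
  · refine sum_congr rfl fun d _ => ?_
    rw [Nat.div_div_eq_div_mul, Nat.div_div_eq_div_mul, mul_comm j d]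
  · intro d hd hd'
    simp only [mem_Ioc, not_and, not_le] at hd hd'
    have h := hd' hd.1
    have : N / d / j = 0 := by
      rw [Nat.div_div_eq_div_mul, mul_comm, ← Nat.div_div_eq_div_mul]
      exact Nat.div_eq_of_lt h
    simp [this, harm_zero]

theorem sumLogDiv_sub_approx {C : ℝ} (hC : 1 ≤ C) {M N : ℕ} (hM : 1 ≤ M) (hMN : M ≤ N)
    (hN : Real.log N ≤ C) :
    |(sumLogDiv N - sumLogDiv M) - (Real.log N ^ 2 - Real.log M ^ 2) / 2| ≤
      C * (1 / (M : ℝ) - 1 / N) := by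
  induction N, hMN using Nat.le_induction with
  | base => simp
  | succ k hk ih =>
    have hk0 : (0 : ℝ) < k := by exact_mod_cast (by omega : 0 < k)
    have hk1 : (1 : ℝ) ≤ k := by exact_mod_cast (by omega : 1 ≤ k)
    have hle : Real.log k ≤ Real.log ((k + 1 : ℕ) : ℝ) :=
      Real.log_le_log hk0 (by push_cast; linarith)
    have ih' := ih (hle.trans hN)
    have e : sumLogDiv (k + 1) = sumLogDiv k + Real.log ((k + 1 : ℕ) : ℝ) / ((k + 1 : ℕ) : ℝ) :=
      sum_Ioc_zero_succ (fun n => Real.log n / n) k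
    have u := sub_le_mul_log_sub hk0 (show (0 : ℝ) < k + 1 by linarith)
    have v := mul_log_sub_le_sub hk0 (show (0 : ℝ) < k + 1 by linarith)
    push_cast at *
    set a := Real.log (k : ℝ)
    set b := Real.log ((k : ℝ) + 1)
    have ha : 0 ≤ a := Real.log_nonneg hk1
    have d1 : b - a ≤ 1 / k := by rw [le_div_iff₀ hk0]; linarith
    have d2 : 1 / ((k : ℝ) + 1) ≤ b - a := by rw [div_le_iff₀ (by linarith)]; linarith
    have hd : 0 ≤ 1 / (k : ℝ) - 1 / (k + 1) := by linarith
    have hd' : 1 / (k : ℝ) * (1 / (k + 1)) = 1 / (k : ℝ) - 1 / (k + 1) := by field_simp; ring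
    have q1 : (b ^ 2 - a ^ 2) / 2 ≤ b * (1 / k) := by nlinarith [sq_nonneg (b - a)]
    have q2 : b * (1 / ((k : ℝ) + 1)) - (b - a) * (1 / ((k : ℝ) + 1)) ≤ (b ^ 2 - a ^ 2) / 2 := by
      nlinarith [sq_nonneg (b - a)]
    have q3 : (b - a) * (1 / ((k : ℝ) + 1)) ≤ 1 / (k : ℝ) - 1 / (k + 1) := by
      rw [← hd']
      exact mul_le_mul_of_nonneg_right d1 (by positivity)
    have q4 : b * (1 / (k : ℝ) - 1 / (k + 1)) ≤ C * (1 / (k : ℝ) - 1 / (k + 1)) :=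
      mul_le_mul_of_nonneg_right hN hd
    have q5 : 1 * (1 / (k : ℝ) - 1 / (k + 1)) ≤ C * (1 / (k : ℝ) - 1 / (k + 1)) :=
      mul_le_mul_of_nonneg_right hC hd
    rw [e, show b / ((k : ℝ) + 1) = b * (1 / ((k : ℝ) + 1)) by ring]
    rw [abs_le] at ih' ⊢
    constructor <;> linarith [ih'.1, ih'.2]

/-- The defect between `log 3 * (N / d - 1)` and the weight whose Mangoldt sum is elementary. -/
noncomputable def mertensDefect (N d : ℕ) : ℝ :=
  Real.log 3 * ((N : ℝ) / d - 1) -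
    ((N : ℝ) / d * (harm (N / d) - harm (N / d / 3)) - ((N / d % 3 : ℕ) : ℝ))

theorem sum_mertensDefect (N : ℕ) :
    ∑ d ∈ Ioc 0 N, ArithmeticFunction.vonMangoldt d * mertensDefect N d =
      Real.log 3 * (N * sumMangoldtDiv N - Chebyshev.psi N) -
      (N * (sumLogDiv N - sumLogDiv (N / 3)) - Real.log (N.factorial) +
        3 * Real.log ((N / 3).factorial)) := by
  rw [← sum_vonMangoldt_mul_div, ← sum_vonMangoldt_mul_div_div N 3,
    ← sum_vonMangoldt_div_mul_harm N, ← sum_vonMangoldt_div_mul_harm_div N 3, psi_nat,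
    sumMangoldtDiv, mul_sum, ← sum_sub_distrib, ← sum_sub_distrib, mul_sum, mul_sum, mul_sum,
    ← sum_sub_distrib, ← sum_add_distrib, ← sum_sub_distrib]
  refine sum_congr rfl fun d _ => ?_
  have h : ((N / d : ℕ) : ℝ) = 3 * ((N / d / 3 : ℕ) : ℝ) + ((N / d % 3 : ℕ) : ℝ) := by
    exact_mod_cast (Nat.div_add_mod (N / d) 3).symm
  rw [mertensDefect, h]
  ring

theorem log_bound_394016 : Real.log (394016 : ℝ) ≤ 12.8847 := by
  have h1 : Real.log (394016 : ℝ) ≤ Real.log ((3 : ℝ) * 2 ^ 17 * (1 + 800 / 393216)) :=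
    Real.log_le_log (by norm_num) (by norm_num)
  rw [Real.log_mul (by norm_num) (by norm_num), Real.log_mul (by norm_num) (by norm_num),
    Real.log_pow] at h1
  have := Real.log_le_sub_one_of_pos (show (0 : ℝ) < 1 + 800 / 393216 by norm_num)
  have := Real.log_two_lt_d9
  have := Real.log_three_lt_d9
  push_cast at h1
  linarith

theorem log_le_of_large {x : ℝ} (hx : 394016 ≤ x) : Real.log x ≤ 0.0000328 * x := by
  refine log_div_self_le (a := 394016) (by linarith [Real.exp_one_lt_d9]) hx ?_
  linarith [log_bound_394016]

theorem mertens_comb_approx (N : ℕ) (hN : 394016 ≤ N) :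
    |((N : ℝ) * (sumLogDiv N - sumLogDiv (N / 3)) - Real.log (N.factorial) +
        3 * Real.log ((N / 3).factorial)) -
      (N : ℝ) * (Real.log 3 * Real.log N - Real.log 3 ^ 2 / 2 - Real.log 3)| ≤ 0.00032 * (N : ℝ) := by
  have hNr : (394016 : ℝ) ≤ N := by exact_mod_cast hN
  have hlog := log_le_of_large hNr
  set ℓ := Real.log (N : ℝ) with hℓ
  have hℓ1 : 1 ≤ ℓ := by
    rw [hℓ, Real.le_log_iff_exp_le (by linarith)]
    linarith [Real.exp_one_lt_d9]
  have f1 := log_div_factorial_bounds N 1 (by norm_num) (by omega)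
  have f3 := log_div_factorial_bounds N 3 (by norm_num) (by omega)
  simp only [Nat.div_one, Nat.cast_one, Real.log_one, div_one, Nat.cast_ofNat] at f1 f3
  set M := N / 3 with hM
  have hM1 : 131338 ≤ M := by omega
  have hMr : (131338 : ℝ) ≤ M := by exact_mod_cast hM1
  have hNM : (N : ℝ) ≤ 3 * M + 2 := by exact_mod_cast (by omega : N ≤ 3 * M + 2)
  have hNM' : 3 * (M : ℝ) ≤ N := by exact_mod_cast (by omega : 3 * M ≤ N)
  have hL := sumLogDiv_sub_approx hℓ1 (show 1 ≤ M by omega) (show M ≤ N by omega) le_rfl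
  set μ := Real.log (M : ℝ) with hμ
  set D := sumLogDiv N - sumLogDiv M
  have hℓM : Real.log (3 * (M : ℝ)) = Real.log 3 + μ :=
    Real.log_mul (by norm_num) (by linarith)
  have hT1 := Real.log_three_gt_d9
  have hT2 := Real.log_three_lt_d9
  set T := Real.log 3
  have δ0 : 0 ≤ ℓ - (T + μ) := by
    rw [← hℓM]; linarith [Real.log_le_log (show 0 < 3 * (M : ℝ) by linarith) hNM']
  have δ1 : (ℓ - (T + μ)) * N ≤ 2 * 1.00001 := by
    have h := mul_log_sub_le_sub (show 0 < 3 * (M : ℝ) by linarith) (show 0 < (N : ℝ) by linarith)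
    rw [hℓM] at h
    have h2 : (N : ℝ) ≤ 1.00001 * (3 * M) := by linarith
    calc (ℓ - (T + μ)) * N ≤ (ℓ - (T + μ)) * (1.00001 * (3 * M)) :=
          mul_le_mul_of_nonneg_left h2 δ0
      _ = 1.00001 * (3 * M * (ℓ - (T + μ))) := by ring
      _ ≤ _ := by linarith
  set δ := ℓ - (T + μ) with hδ
  have hμe : μ = ℓ - T - δ := by rw [hδ]; ring
  have hδs : δ ≤ 1 := by nlinarith
  have e1 : (ℓ ^ 2 - μ ^ 2) / 2 = T * ℓ - T ^ 2 / 2 + δ * (ℓ - T - δ / 2) := by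
    rw [hμe]; ring
  rw [e1] at hL
  have hb : ℓ * (1 / (M : ℝ) - 1 / N) * N ≤ 3.0001 * ℓ := by
    have : (1 / (M : ℝ) - 1 / N) * N ≤ 3.0001 := by
      rw [sub_mul, one_div_mul_cancel (by linarith), one_div_mul_eq_div]
      have : (N : ℝ) / M ≤ 3.0001 := by rw [div_le_iff₀ (by linarith)]; linarith
      linarith
    calc _ = ℓ * ((1 / (M : ℝ) - 1 / N) * N) := by ring
      _ ≤ ℓ * 3.0001 := mul_le_mul_of_nonneg_left this (by linarith)
      _ = _ := by ring
  rw [abs_le] at hL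
  have g1 := mul_le_mul_of_nonneg_right hL.1 (show (0 : ℝ) ≤ N by linarith)
  have g2 := mul_le_mul_of_nonneg_right hL.2 (show (0 : ℝ) ≤ N by linarith)
  have hμ0 : 0 ≤ ℓ - T - δ := by rw [← hμe]; exact Real.log_nonneg (by linarith)
  have k1 : 0 ≤ δ * (ℓ - T - δ / 2) * N := by
    have : 0 ≤ ℓ - T - δ / 2 := by linarith
    positivity
  have k2 : δ * (ℓ - T - δ / 2) * N ≤ 2.1 * ℓ := by
    have : δ * N * (ℓ - T - δ / 2) ≤ (2 * 1.00001) * ℓ :=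
      mul_le_mul δ1 (by linarith) (by linarith) (by norm_num)
    linarith
  have hN0 : (0 : ℝ) ≤ N := by linarith
  rw [abs_le]
  constructor <;> linarith [f1.1, f1.2, f3.1, f3.2]

theorem sumMangoldtDiv_approx (N : ℕ) (hN : 394016 ≤ N) :
    |sumMangoldtDiv N - (Chebyshev.psi N / N + Real.log N - Real.log 3 / 2 - 1 +
      (∑ d ∈ Ioc 0 N, ArithmeticFunction.vonMangoldt d * mertensDefect N d) /
        (N * Real.log 3))| ≤ 0.0003 := by
  have hNr : (394016 : ℝ) ≤ N := by exact_mod_cast hN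
  have hN0 : (N : ℝ) ≠ 0 := by linarith
  have h := mertens_comb_approx N hN
  have e := sum_mertensDefect N
  set V := ((N : ℝ) * (sumLogDiv N - sumLogDiv (N / 3)) - Real.log (N.factorial) +
        3 * Real.log ((N / 3).factorial))
  have hT1 := Real.log_three_gt_d9
  have hT2 := Real.log_three_lt_d9
  set T := Real.log 3
  have hT0 : T ≠ 0 := by linarith
  rw [e]
  have : sumMangoldtDiv N - (Chebyshev.psi N / N + Real.log N - T / 2 - 1 +
      (T * (N * sumMangoldtDiv N - Chebyshev.psi N) - V) / (N * T)) =
      (V - N * (T * Real.log N - T ^ 2 / 2 - T)) / (N * T) := by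
    field_simp
    ring
  rw [this, abs_div, abs_of_pos (show 0 < N * T by nlinarith), div_le_iff₀ (by nlinarith)]
  nlinarith

/-- The truncation of a real number to the unit interval. -/
noncomputable def clip (t : ℝ) : ℝ := max 0 (min 1 t)

theorem clip_of_le {t : ℝ} (h : t ≤ 0) : clip t = 0 := by
  unfold clip; rw [min_eq_right (by linarith), max_eq_left h]

theorem clip_of_ge {t : ℝ} (h : 1 ≤ t) : clip t = 1 := by
  unfold clip; rw [min_eq_left h, max_eq_right zero_le_one]

theorem clip_of_mem {t : ℝ} (h0 : 0 ≤ t) (h1 : t ≤ 1) : clip t = t := by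
  unfold clip; rw [min_eq_right h1, max_eq_right h0]

theorem harm_eq_harmonic (m : ℕ) : harm m = ((harmonic m : ℚ) : ℝ) := by
  induction m with
  | zero => simp [harm_zero]
  | succ n ih => rw [harm_succ, harmonic_succ, ih]; push_cast; ring

theorem tendsto_harm_three_mul_sub :
    Tendsto (fun k : ℕ => Real.log 3 - (harm (3 * k) - harm k)) atTop (nhds 0) := by
  have h := Real.tendsto_harmonic_sub_log
  have h3 : Tendsto (fun k : ℕ => ((harmonic (3 * k) : ℚ) : ℝ) - Real.log ((3 * k : ℕ) : ℝ)) atTop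
      (nhds Real.eulerMascheroniConstant) :=
    h.comp (tendsto_id.const_mul_atTop' (by norm_num : 0 < 3))
  have := h.sub h3
  rw [sub_self] at this
  refine this.congr' ?_
  filter_upwards [eventually_ge_atTop 1] with k hk
  have hk0 : (k : ℝ) ≠ 0 := by exact_mod_cast (by omega : k ≠ 0)
  rw [harm_eq_harmonic, harm_eq_harmonic]
  push_cast
  rw [Real.log_mul (by norm_num) hk0]
  ring

theorem harm_three_mul_succ (k : ℕ) :
    harm (3 * (k + 1)) - harm (k + 1) = harm (3 * k) - harm k +
      (1 / (3 * (k : ℝ) + 1) + 1 / (3 * k + 2) - 2 / (3 * k + 3)) := by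
  rw [show 3 * (k + 1) = 3 * k + 1 + 1 + 1 by ring, harm_succ, harm_succ, harm_succ, harm_succ]
  push_cast
  have : (k : ℝ) + 1 ≠ 0 := by positivity
  have : 3 * (k : ℝ) + 1 ≠ 0 := by positivity
  have : 3 * (k : ℝ) + 2 ≠ 0 := by positivity
  field_simp
  ring

theorem tendsto_one_div_three_mul_add {c : ℝ} :
    Tendsto (fun k : ℕ => 1 / (3 * (k : ℝ) + c)) atTop (nhds 0) := by
  refine Tendsto.const_div_atTop (tendsto_atTop_add_const_right _ _ ?_) 1
  exact tendsto_natCast_atTop_atTop.const_mul_atTop (by norm_num)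

theorem log_three_sub_harm_bounds (k : ℕ) :
    1 / (3 * (k : ℝ) + 1) ≤ Real.log 3 - (harm (3 * k) - harm k) ∧
      Real.log 3 - (harm (3 * k) - harm k) ≤ 1 / (3 * (k : ℝ) + 1 / 2) := by
  constructor
  · have hlim := tendsto_harm_three_mul_sub.sub (tendsto_one_div_three_mul_add (c := 1))
    rw [sub_zero] at hlim
    have hanti : Antitone fun k : ℕ =>
        Real.log 3 - (harm (3 * k) - harm k) - 1 / (3 * (k : ℝ) + 1) := by
      refine antitone_nat_of_succ_le fun n => ?_
      rw [harm_three_mul_succ]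
      push_cast
      have : 1 / (3 * (n : ℝ) + 2) + 1 / (3 * (n + 1) + 1) - 2 / (3 * n + 3) =
        2 / ((3 * (n : ℝ) + 2) * (3 * (n + 1) + 1) * (3 * n + 3)) := by
        field_simp
        ring
      have : 0 ≤ 1 / (3 * (n : ℝ) + 2) + 1 / (3 * (n + 1) + 1) - 2 / (3 * n + 3) := by
        rw [this]; positivity
      linarith
    have := hanti.le_of_tendsto hlim k
    linarith
  · have hlim := tendsto_harm_three_mul_sub.sub (tendsto_one_div_three_mul_add (c := 1 / 2))
    rw [sub_zero] at hlim
    have hmono : Monotone fun k : ℕ =>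
        Real.log 3 - (harm (3 * k) - harm k) - 1 / (3 * (k : ℝ) + 1 / 2) := by
      refine monotone_nat_of_le_succ fun n => ?_
      rw [harm_three_mul_succ]
      push_cast
      have e : 1 / (3 * (n : ℝ) + 1 / 2) - 1 / (3 * (n + 1) + 1 / 2) -
          (1 / (3 * (n : ℝ) + 1) + 1 / (3 * n + 2) - 2 / (3 * n + 3)) =
        (36 * (n : ℝ) ^ 2 + 93 * n + 37) / ((6 * (n : ℝ) + 1) * (6 * n + 7) * (3 * n + 1) *
          (3 * n + 2) * (3 * n + 3)) := by
        field_simp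
        ring
      have : 0 ≤ 1 / (3 * (n : ℝ) + 1 / 2) - 1 / (3 * (n + 1) + 1 / 2) -
          (1 / (3 * (n : ℝ) + 1) + 1 / (3 * n + 2) - 2 / (3 * n + 3)) := by
        rw [e]; positivity
      linarith
    have := hmono.ge_of_tendsto hlim k
    linarith

/-- The value of `mertensDefect` as a function of the quotient `y` and its integer part `m`. -/
noncomputable def defectAt (m : ℕ) (y : ℝ) : ℝ :=
  Real.log 3 * (y - 1) - (y * (harm m - harm (m / 3)) - ((m % 3 : ℕ) : ℝ))

/-- The piecewise linear part of the defect on `[1, 6]`. -/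
noncomputable def clipComb (y : ℝ) : ℝ :=
  (Real.log 3 - 1) * clip (y - 1) + (Real.log 3 - 3 / 2) * clip (y - 2) +
    (Real.log 3 - 5 / 6) * clip (y - 3) + (Real.log 3 - 13 / 12) * clip (y - 4) +
    (Real.log 3 - 77 / 60) * clip (y - 5)

theorem harm_values : harm 1 = 1 ∧ harm 2 = 3 / 2 ∧ harm 3 = 11 / 6 ∧ harm 4 = 25 / 12 ∧
    harm 5 = 137 / 60 ∧ harm 6 = 49 / 20 := by
  have h1 : harm 1 = 1 := by rw [show (1 : ℕ) = 0 + 1 from rfl, harm_succ, harm_zero]; norm_num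
  have h2 : harm 2 = 3 / 2 := by
    have h := harm_succ 1
    rw [h1] at h
    norm_num at h
    exact h
  have h3 : harm 3 = 11 / 6 := by
    have h := harm_succ 2
    rw [h2] at h
    norm_num at h
    exact h
  have h4 : harm 4 = 25 / 12 := by
    have h := harm_succ 3
    rw [h3] at h
    norm_num at h
    exact h
  have h5 : harm 5 = 137 / 60 := by
    have h := harm_succ 4
    rw [h4] at h
    norm_num at h
    exact h
  have h6 : harm 6 = 49 / 20 := by
    have h := harm_succ 5
    rw [h5] at h
    norm_num at h
    exact h
  exact ⟨h1, h2, h3, h4, h5, h6⟩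

theorem defectAt_eq_clipComb {m : ℕ} {y : ℝ} (hm : 1 ≤ m) (hm6 : m < 6) (h0 : (m : ℝ) ≤ y)
    (h1 : y < m + 1) : defectAt m y = clipComb y := by
  obtain ⟨e1, e2, e3, e4, e5, e6⟩ := harm_values
  unfold defectAt clipComb
  interval_cases m <;> push_cast at h0 h1 <;>
    simp only [Nat.reduceDiv, Nat.reduceMod, e1, e2, e3, e4, e5, harm_zero]
  · rw [clip_of_mem (t := y - 1) (by linarith) (by linarith), clip_of_le (t := y - 2) (by linarith),
      clip_of_le (t := y - 3) (by linarith), clip_of_le (t := y - 4) (by linarith),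
      clip_of_le (t := y - 5) (by linarith)]
    push_cast; ring
  · rw [clip_of_ge (t := y - 1) (by linarith), clip_of_mem (t := y - 2) (by linarith) (by linarith),
      clip_of_le (t := y - 3) (by linarith), clip_of_le (t := y - 4) (by linarith),
      clip_of_le (t := y - 5) (by linarith)]
    push_cast; ring
  · rw [clip_of_ge (t := y - 1) (by linarith), clip_of_ge (t := y - 2) (by linarith),
      clip_of_mem (t := y - 3) (by linarith) (by linarith), clip_of_le (t := y - 4) (by linarith),
      clip_of_le (t := y - 5) (by linarith)]
    push_cast; ring
  · rw [clip_of_ge (t := y - 1) (by linarith), clip_of_ge (t := y - 2) (by linarith),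
      clip_of_ge (t := y - 3) (by linarith), clip_of_mem (t := y - 4) (by linarith) (by linarith),
      clip_of_le (t := y - 5) (by linarith)]
    push_cast; ring
  · rw [clip_of_ge (t := y - 1) (by linarith), clip_of_ge (t := y - 2) (by linarith),
      clip_of_ge (t := y - 3) (by linarith), clip_of_ge (t := y - 4) (by linarith),
      clip_of_mem (t := y - 5) (by linarith) (by linarith)]
    push_cast; ring

theorem defectAt_large {m : ℕ} {y : ℝ} (hm : 6 ≤ m) (h0 : (m : ℝ) ≤ y) (h1 : y < m + 1) :
    5 * Real.log 3 - 57 / 10 ≤ defectAt m y ∧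
      defectAt m y ≤ 5 * Real.log 3 - 57 / 10 + 0.197 := by
  have hT1 := Real.log_three_gt_d9
  have hT2 := Real.log_three_lt_d9
  obtain ⟨k, r, hr, rfl⟩ : ∃ k r, r < 3 ∧ m = 3 * k + r :=
    ⟨m / 3, m % 3, Nat.mod_lt _ (by norm_num), (Nat.div_add_mod m 3).symm⟩
  have hk : 2 ≤ k := by omega
  have hd : (3 * k + r) / 3 = k := by omega
  have hmod : (3 * k + r) % 3 = r := by omega
  unfold defectAt
  rw [hd, hmod]
  obtain ⟨b1, b2⟩ := log_three_sub_harm_bounds k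
  have hk2 : (2 : ℝ) ≤ k := by exact_mod_cast hk
  have hexact : k = 2 → harm (3 * k) - harm k = 0.95 := by
    rintro rfl
    obtain ⟨e1, e2, e3, e4, e5, e6⟩ := harm_values
    norm_num [e2, e6]
  generalize Real.log 3 = T at *
  have c1 : 1 / (3 * (k : ℝ) + 1) ≤ 1 / 7 :=
    one_div_le_one_div_of_le (by norm_num) (by linarith)
  have p1 : 0 < 1 / (3 * (k : ℝ) + 1) := by positivity
  have p2 : 0 < 1 / (3 * (k : ℝ) + 2) := by positivity
  have m1 : 1 / (3 * (k : ℝ) + 1) * (3 * k + 1) = 1 := by field_simp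
  have m2 : 1 / (3 * (k : ℝ) + 2) * (3 * k + 2) = 1 := by field_simp
  have m3 : 1 / (3 * (k : ℝ) + 1 / 2) * (3 * k + 1 / 2) = 1 := by field_simp
  have p3 : 0 < 1 / (3 * (k : ℝ) + 1 / 2) := by positivity
  have c3 : 1 / (3 * (k : ℝ) + 1 / 2) ≤ 2 / 13 := by
    rw [div_le_div_iff₀ (by positivity) (by norm_num)]; linarith
  have c2 : 1 / (3 * (k : ℝ) + 2) ≤ 1 / 8 :=
    one_div_le_one_div_of_le (by norm_num) (by linarith)
  have key : (3 * (k : ℝ) + 2) * (1 / (3 * (k : ℝ) + 1 / 2) - 1 / (3 * (k : ℝ) + 1)) ≤ 0.088 := by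
    have : (3 * (k : ℝ) + 2) * (1 / (3 * (k : ℝ) + 1 / 2) - 1 / (3 * (k : ℝ) + 1)) =
      (3 * (k : ℝ) + 2) / ((6 * k + 1) * (3 * k + 1)) := by field_simp; ring
    rw [this, div_le_iff₀ (by positivity)]
    nlinarith
  have hle : 1 / (3 * (k : ℝ) + 1 / 2) - 1 / (3 * (k : ℝ) + 1) ≤ 1 / (3 * (k : ℝ) + 2) := by
    have : 1 / (3 * (k : ℝ) + 1 / 2) - 1 / (3 * (k : ℝ) + 1) =
      1 / ((6 * k + 1) * (3 * k + 1)) := by field_simp; ring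
    rw [this]
    refine one_div_le_one_div_of_le (by positivity) ?_
    nlinarith
  interval_cases r
  · simp only [add_zero] at *
    push_cast at h0 h1 ⊢
    generalize harm (3 * k) - harm k = h at *
    have hy0 : 0 ≤ y := by linarith
    constructor
    · rcases hk.eq_or_lt with h2 | h3
      · have := hexact h2.symm
        subst h2
        subst this
        push_cast at *
        nlinarith
      · have hk3 : (3 : ℝ) ≤ k := by exact_mod_cast h3
        have : 1 / (3 * (k : ℝ) + 1) ≤ 1 / 10 :=
          one_div_le_one_div_of_le (by norm_num) (by linarith)
        have : 3 * k * (1 / (3 * (k : ℝ) + 1)) ≤ y * (T - h) :=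
          mul_le_mul h0 b1 p1.le hy0
        linarith
    · have : y * (T - h) ≤ (3 * k + 1) * (1 / (3 * (k : ℝ) + 1 / 2)) :=
        mul_le_mul h1.le b2 (p1.le.trans b1) (by positivity)
      linarith
  · rw [harm_succ]
    push_cast at h0 h1 ⊢
    have e : ∀ h k' : ℝ, T * (y - 1) - (y * (h + 1 / (3 * (k : ℝ) + 1) - k') - 1) =
        y * (T - (h - k') - 1 / (3 * (k : ℝ) + 1)) - T + 1 := by intros; ring
    rw [e]
    generalize harm (3 * k) - harm k = h at *
    have hy0 : 0 ≤ y := by linarith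
    constructor
    · have : 0 ≤ y * (T - h - 1 / (3 * (k : ℝ) + 1)) := mul_nonneg hy0 (by linarith)
      linarith
    · have : y * (T - h - 1 / (3 * (k : ℝ) + 1)) ≤
        (3 * k + 2) * (1 / (3 * (k : ℝ) + 1 / 2) - 1 / (3 * (k : ℝ) + 1)) :=
        mul_le_mul (by linarith) (by linarith) (by linarith) (by positivity)
      linarith
  · rw [show 3 * k + 2 = 3 * k + 1 + 1 from rfl, harm_succ, harm_succ]
    push_cast at h0 h1 ⊢
    have e : ∀ h k' : ℝ, T * (y - 1) - (y * (h + 1 / (3 * (k : ℝ) + 1) +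
        1 / (3 * (k : ℝ) + 1 + 1) - k') - 2) =
        y * (T - (h - k') - 1 / (3 * (k : ℝ) + 1)) - y * (1 / (3 * (k : ℝ) + 2)) - T + 2 := by
      intro h k'
      rw [show 3 * (k : ℝ) + 1 + 1 = 3 * k + 2 by ring]; ring
    rw [e]
    generalize harm (3 * k) - harm k = h at *
    have hy0 : 0 ≤ y := by linarith
    constructor
    · rcases hk.eq_or_lt with h2 | h3
      · have := hexact h2.symm
        subst h2
        subst this
        push_cast at *
        nlinarith
      · have hk3 : (3 : ℝ) ≤ k := by exact_mod_cast h3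
        have q1 : 0 ≤ y * (T - h - 1 / (3 * (k : ℝ) + 1)) := mul_nonneg hy0 (by linarith)
        have q2 : 1 / (3 * (k : ℝ) + 2) ≤ 1 / 11 :=
          one_div_le_one_div_of_le (by norm_num) (by linarith)
        have q3 : y * (1 / (3 * (k : ℝ) + 2)) ≤ (3 * k + 3) * (1 / (3 * (k : ℝ) + 2)) :=
          mul_le_mul_of_nonneg_right (by linarith) p2.le
        linarith
    · have q1 : (y - (3 * k + 2)) * (T - h - 1 / (3 * (k : ℝ) + 1) - 1 / (3 * (k : ℝ) + 2)) ≤ 0 :=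
        mul_nonpos_of_nonneg_of_nonpos (by linarith) (by linarith)
      have q2 : (3 * k + 2) * (T - h - 1 / (3 * (k : ℝ) + 1)) ≤
        (3 * k + 2) * (1 / (3 * (k : ℝ) + 1 / 2) - 1 / (3 * (k : ℝ) + 1)) :=
        mul_le_mul_of_nonneg_left (by linarith) (by positivity)
      linarith

theorem integral_step (k y : ℝ) :
    ∫ v in k..(k + 1), (if v ≤ y then (1 : ℝ) else 0) = clip (y - k) := by
  have hIntegrable : ∀ a b : ℝ,
      IntervalIntegrable (fun v => if v ≤ y then (1 : ℝ) else 0) MeasureTheory.volume a b := by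
    intro a b
    refine AntitoneOn.intervalIntegrable fun u _ v _ huv => ?_
    split_ifs <;> linarith
  have hone : ∀ a b : ℝ, a ≤ b → b ≤ y →
      ∫ v in a..b, (if v ≤ y then (1 : ℝ) else 0) = b - a := by
    intro a b hab hb
    rw [intervalIntegral.integral_congr (g := fun _ => (1 : ℝ))]
    · simp
    · intro v hv
      rw [Set.uIcc_of_le hab] at hv
      simp [hv.2.trans hb]
  have hzero : ∀ a b : ℝ, a ≤ b → y ≤ a →
      ∫ v in a..b, (if v ≤ y then (1 : ℝ) else 0) = 0 := by
    intro a b hab ha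
    rw [intervalIntegral.integral_of_le hab,
      MeasureTheory.setIntegral_congr_fun measurableSet_Ioc (g := fun _ => (0 : ℝ))]
    · simp
    · intro v hv
      simp [not_le.2 (ha.trans_lt hv.1)]
  rcases le_total y k with h | h
  · rw [hzero k (k + 1) (by linarith) h, clip_of_le (by linarith)]
  rcases le_total (k + 1) y with h' | h'
  · rw [hone k (k + 1) (by linarith) h', clip_of_ge (by linarith)]; ring
  · rw [← intervalIntegral.integral_add_adjacent_intervals (hIntegrable k y) (hIntegrable y (k + 1)),
      hone k y h le_rfl, hzero y (k + 1) h' le_rfl, clip_of_mem (by linarith) (by linarith)]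
    ring

theorem psi_div_eq_sum (N : ℕ) {v : ℝ} (hv : 1 ≤ v) :
    Chebyshev.psi (N / v) = ∑ d ∈ Ioc 0 N,
      ArithmeticFunction.vonMangoldt d * (if v ≤ (N : ℝ) / d then (1 : ℝ) else 0) := by
  have hle : (N : ℝ) / v ≤ N := div_le_self (by positivity) hv
  have hsub : Ioc 0 ⌊(N : ℝ) / v⌋₊ ⊆ Ioc 0 N :=
    Ioc_subset_Ioc le_rfl (by simpa using Nat.floor_mono hle)
  unfold Chebyshev.psi
  rw [← sum_subset hsub]
  · refine sum_congr rfl fun d hd => ?_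
    rw [mem_Ioc] at hd
    have hd0 : (0 : ℝ) < d := by exact_mod_cast hd.1
    have := (Nat.le_floor_iff (by positivity)).1 hd.2
    rw [if_pos, mul_one]
    rw [le_div_iff₀ (by linarith)] at this
    rw [le_div_iff₀ hd0]
    linarith
  · intro d hd hd'
    simp only [mem_Ioc, not_and, not_le] at hd hd'
    have hd0 : (0 : ℝ) < d := by exact_mod_cast hd.1
    have := (Nat.floor_lt (by positivity)).1 (hd' hd.1)
    rw [if_neg, mul_zero]
    rw [div_lt_iff₀ (by linarith)] at this
    rw [not_le, div_lt_iff₀ hd0]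
    linarith

theorem sum_vonMangoldt_clip_eq (N : ℕ) {k : ℝ} (hk : 1 ≤ k) :
    ∑ d ∈ Ioc 0 N, ArithmeticFunction.vonMangoldt d * clip ((N : ℝ) / d - k) =
      ∫ v in k..(k + 1), Chebyshev.psi (N / v) := by
  rw [intervalIntegral.integral_congr (g := fun v => ∑ d ∈ Ioc 0 N,
      ArithmeticFunction.vonMangoldt d * (if v ≤ (N : ℝ) / d then (1 : ℝ) else 0))]
  · rw [intervalIntegral.integral_finsetSum]
    · refine sum_congr rfl fun d _ => ?_
      rw [intervalIntegral.integral_const_mul, integral_step]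
    · intro d _
      refine IntervalIntegrable.const_mul ?_ _
      refine AntitoneOn.intervalIntegrable fun u _ v _ huv => ?_
      split_ifs <;> linarith
  · intro v hv
    rw [Set.uIcc_of_le (by linarith)] at hv
    exact psi_div_eq_sum N (hk.trans hv.1)

theorem sum_vonMangoldt_clip_bounds (N : ℕ) (hN : 394016 ≤ N) {k : ℝ} (hk : 1 ≤ k) (hk5 : k ≤ 5) :
    0.9203 * N * Real.log ((k + 1) / k) ≤
        ∑ d ∈ Ioc 0 N, ArithmeticFunction.vonMangoldt d * clip ((N : ℝ) / d - k) ∧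
      ∑ d ∈ Ioc 0 N, ArithmeticFunction.vonMangoldt d * clip ((N : ℝ) / d - k) ≤
        1.1127 * N * Real.log ((k + 1) / k) := by
  have hNr : (394016 : ℝ) ≤ N := by exact_mod_cast hN
  rw [sum_vonMangoldt_clip_eq N hk]
  have hb : ∀ v ∈ Set.Icc k (k + 1), 0.9203 * N * (1 / v) ≤ Chebyshev.psi (N / v) ∧
      Chebyshev.psi (N / v) ≤ 1.1127 * N * (1 / v) := by
    intro v hv
    have hv0 : 0 < v := by linarith [hv.1]
    have h := psi_bounds (x := N / v) (by
      rw [le_div_iff₀ hv0]; linarith [hv.2])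
    rw [show (0.9203 : ℝ) * (N / v) = 0.9203 * N * (1 / v) by ring,
      show (1.1127 : ℝ) * (N / v) = 1.1127 * N * (1 / v) by ring] at h
    exact h
  have hI : IntervalIntegrable (fun v : ℝ => Chebyshev.psi (N / v)) MeasureTheory.volume k (k + 1) := by
    refine AntitoneOn.intervalIntegrable fun u hu v _ huv => Chebyshev.psi_mono ?_
    rw [Set.uIcc_of_le (by linarith)] at hu
    exact div_le_div_of_nonneg_left (by linarith) (by linarith [hu.1]) huv
  have h0 : (0 : ℝ) ∉ Set.uIcc k (k + 1) := by
    rw [Set.uIcc_of_le (by linarith)]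
    intro h; linarith [h.1]
  have hJ : ∀ c : ℝ, IntervalIntegrable (fun v : ℝ => c * (1 / v)) MeasureTheory.volume k (k + 1) :=
    fun c => (intervalIntegral.intervalIntegrable_one_div (fun v hv => by
      rintro rfl; exact h0 hv) continuousOn_id).const_mul c
  have e : ∀ c : ℝ, ∫ v in k..(k + 1), c * (1 / v) = c * Real.log ((k + 1) / k) := by
    intro c
    rw [intervalIntegral.integral_const_mul, integral_one_div h0]
  rw [← e, ← e]
  exact ⟨intervalIntegral.integral_mono_on (by linarith) (hJ _) hI fun v hv => (hb v hv).1,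
    intervalIntegral.integral_mono_on (by linarith) hI (hJ _) fun v hv => (hb v hv).2⟩

theorem mertensDefect_bounds {N d : ℕ} (hd : d ∈ Ioc 0 N) :
    clipComb ((N : ℝ) / d) ≤ mertensDefect N d ∧
      mertensDefect N d ≤ clipComb ((N : ℝ) / d) +
        0.197 * (if (6 : ℝ) ≤ (N : ℝ) / d then (1 : ℝ) else 0) := by
  rw [mem_Ioc] at hd
  have hd0 : (0 : ℝ) < d := by exact_mod_cast hd.1
  have h0 : ((N / d : ℕ) : ℝ) ≤ (N : ℝ) / d := Nat.cast_div_le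
  have h1 : (N : ℝ) / d < ((N / d : ℕ) : ℝ) + 1 := by
    rw [div_lt_iff₀ hd0]
    have := Nat.lt_mul_div_succ N hd.1
    have h : (N : ℝ) < (d : ℝ) * (((N / d : ℕ) : ℝ) + 1) := by exact_mod_cast this
    linarith
  have hm : 1 ≤ N / d := (Nat.one_le_div_iff hd.1).2 hd.2
  change clipComb ((N : ℝ) / d) ≤ defectAt (N / d) ((N : ℝ) / d) ∧
    defectAt (N / d) ((N : ℝ) / d) ≤ _
  rcases lt_or_ge (N / d) 6 with h6 | h6
  · rw [defectAt_eq_clipComb hm h6 h0 h1]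
    refine ⟨le_rfl, ?_⟩
    have : (0 : ℝ) ≤ if (6 : ℝ) ≤ (N : ℝ) / d then (1 : ℝ) else 0 := by split_ifs <;> norm_num
    linarith
  · have h6r : (6 : ℝ) ≤ (N : ℝ) / d := le_trans (by exact_mod_cast h6) h0
    have e : clipComb ((N : ℝ) / d) = 5 * Real.log 3 - 57 / 10 := by
      unfold clipComb
      rw [clip_of_ge (by linarith), clip_of_ge (by linarith), clip_of_ge (by linarith),
        clip_of_ge (by linarith), clip_of_ge (by linarith)]
      ring
    rw [e, if_pos h6r]
    have := defectAt_large h6 h0 h1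
    constructor <;> linarith [this.1, this.2]

theorem sum_mertensDefect_bounds (N : ℕ) (hN : 394016 ≤ N) :
    -0.0823 * (N : ℝ) ≤ ∑ d ∈ Ioc 0 N, ArithmeticFunction.vonMangoldt d * mertensDefect N d ∧
      ∑ d ∈ Ioc 0 N, ArithmeticFunction.vonMangoldt d * mertensDefect N d ≤ 0.0206 * (N : ℝ) := by
  have hNr : (394016 : ℝ) ≤ N := by exact_mod_cast hN
  have hlow : ∑ d ∈ Ioc 0 N, ArithmeticFunction.vonMangoldt d * clipComb ((N : ℝ) / d) ≤
      ∑ d ∈ Ioc 0 N, ArithmeticFunction.vonMangoldt d * mertensDefect N d :=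
    sum_le_sum fun d hd => mul_le_mul_of_nonneg_left (mertensDefect_bounds hd).1
      ArithmeticFunction.vonMangoldt_nonneg
  have hup : ∑ d ∈ Ioc 0 N, ArithmeticFunction.vonMangoldt d * mertensDefect N d ≤
      ∑ d ∈ Ioc 0 N, ArithmeticFunction.vonMangoldt d * clipComb ((N : ℝ) / d) +
        0.197 * Chebyshev.psi (N / 6) := by
    rw [psi_div_eq_sum N (by norm_num : (1 : ℝ) ≤ 6), mul_sum, ← sum_add_distrib]
    refine sum_le_sum fun d hd => ?_
    have := mul_le_mul_of_nonneg_left (mertensDefect_bounds hd).2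
      (ArithmeticFunction.vonMangoldt_nonneg (n := d))
    linarith
  have h6 := (psi_bounds (x := N / 6) (by linarith)).2
  have e : ∑ d ∈ Ioc 0 N, ArithmeticFunction.vonMangoldt d * clipComb ((N : ℝ) / d) =
      (Real.log 3 - 1) * ∑ d ∈ Ioc 0 N, ArithmeticFunction.vonMangoldt d * clip ((N : ℝ) / d - 1) +
      (Real.log 3 - 3 / 2) *
        ∑ d ∈ Ioc 0 N, ArithmeticFunction.vonMangoldt d * clip ((N : ℝ) / d - 2) +
      (Real.log 3 - 5 / 6) *
        ∑ d ∈ Ioc 0 N, ArithmeticFunction.vonMangoldt d * clip ((N : ℝ) / d - 3) +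
      (Real.log 3 - 13 / 12) *
        ∑ d ∈ Ioc 0 N, ArithmeticFunction.vonMangoldt d * clip ((N : ℝ) / d - 4) +
      (Real.log 3 - 77 / 60) *
        ∑ d ∈ Ioc 0 N, ArithmeticFunction.vonMangoldt d * clip ((N : ℝ) / d - 5) := by
    rw [mul_sum, mul_sum, mul_sum, mul_sum, mul_sum, ← sum_add_distrib, ← sum_add_distrib,
      ← sum_add_distrib, ← sum_add_distrib]
    refine sum_congr rfl fun d _ => ?_
    unfold clipComb
    ring
  rw [e] at hlow hup
  have g1 := sum_vonMangoldt_clip_bounds N hN (k := 1) (by norm_num) (by norm_num)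
  have g2 := sum_vonMangoldt_clip_bounds N hN (k := 2) (by norm_num) (by norm_num)
  have g3 := sum_vonMangoldt_clip_bounds N hN (k := 3) (by norm_num) (by norm_num)
  have g4 := sum_vonMangoldt_clip_bounds N hN (k := 4) (by norm_num) (by norm_num)
  have g5 := sum_vonMangoldt_clip_bounds N hN (k := 5) (by norm_num) (by norm_num)
  have l1 : Real.log ((1 + 1) / 1) = Real.log 2 := by norm_num
  have l2 : Real.log ((2 + 1) / 2) = Real.log 3 - Real.log 2 := by
    rw [Real.log_div (by norm_num) (by norm_num)]; norm_num
  have l4' : Real.log 4 = 2 * Real.log 2 := by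
    rw [show (4 : ℝ) = 2 ^ 2 by norm_num, Real.log_pow]; norm_num
  have l3 : Real.log ((3 + 1) / 3) = 2 * Real.log 2 - Real.log 3 := by
    rw [Real.log_div (by norm_num) (by norm_num), ← l4']; norm_num
  have l4 : Real.log ((4 + 1) / 4) = Real.log 5 - 2 * Real.log 2 := by
    rw [Real.log_div (by norm_num) (by norm_num), ← l4']; norm_num
  have l5 : Real.log ((5 + 1) / 5) = Real.log 2 + Real.log 3 - Real.log 5 := by
    rw [Real.log_div (by norm_num) (by norm_num), ← Real.log_mul (by norm_num) (by norm_num)]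
    norm_num
  rw [l1] at g1
  rw [l2] at g2
  rw [l3] at g3
  rw [l4] at g4
  rw [l5] at g5
  have := Real.log_two_gt_d9
  have := Real.log_two_lt_d9
  have hT1 := Real.log_three_gt_d9
  have hT2 := Real.log_three_lt_d9
  have := Real.log_five_gt_d9
  have := Real.log_five_lt_d9
  have low : ∀ {G L l : ℝ}, 0.9203 * N * L ≤ G → l ≤ L → 0.9203 * l * N ≤ G := by
    intro G L l h1 h2
    have := mul_le_mul_of_nonneg_left h2 (show (0 : ℝ) ≤ 0.9203 * N by linarith)
    linarith
  have upp : ∀ {G L l : ℝ}, G ≤ 1.1127 * N * L → L ≤ l → G ≤ 1.1127 * l * N := by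
    intro G L l h1 h2
    have := mul_le_mul_of_nonneg_left h2 (show (0 : ℝ) ≤ 1.1127 * N by linarith)
    linarith
  have a1 := low (l := 0.693147) g1.1 (by linarith)
  have b1 := upp (l := 0.693148) g1.2 (by linarith)
  have a2 := low (l := 0.405465) g2.1 (by linarith)
  have b2 := upp (l := 0.405466) g2.2 (by linarith)
  have a3 := low (l := 0.287682) g3.1 (by linarith)
  have b3 := upp (l := 0.287683) g3.2 (by linarith)
  have a4 := low (l := 0.223143) g4.1 (by linarith)
  have b4 := upp (l := 0.223144) g4.2 (by linarith)
  have a5 := low (l := 0.182321) g5.1 (by linarith)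
  have b5 := upp (l := 0.182322) g5.2 (by linarith)
  clear g1 g2 g3 g4 g5 low upp e l1 l2 l3 l4 l5 l4'
  generalize ∑ d ∈ Ioc 0 N, ArithmeticFunction.vonMangoldt d * mertensDefect N d = W at *
  generalize ∑ d ∈ Ioc 0 N, ArithmeticFunction.vonMangoldt d * clip ((N : ℝ) / d - 1) = G1 at *
  generalize ∑ d ∈ Ioc 0 N, ArithmeticFunction.vonMangoldt d * clip ((N : ℝ) / d - 2) = G2 at *
  generalize ∑ d ∈ Ioc 0 N, ArithmeticFunction.vonMangoldt d * clip ((N : ℝ) / d - 3) = G3 at *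
  generalize ∑ d ∈ Ioc 0 N, ArithmeticFunction.vonMangoldt d * clip ((N : ℝ) / d - 4) = G4 at *
  generalize ∑ d ∈ Ioc 0 N, ArithmeticFunction.vonMangoldt d * clip ((N : ℝ) / d - 5) = G5 at *
  generalize Real.log 3 = T at *
  have hG : 0 ≤ G1 + G2 + G3 + G4 + G5 := by linarith
  have t1 : (1.0986122 - T) * (G1 + G2 + G3 + G4 + G5) ≤ 0 :=
    mul_nonpos_of_nonpos_of_nonneg (by linarith) hG
  have t2 : 0 ≤ (1.0986123 - T) * (G1 + G2 + G3 + G4 + G5) :=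
    mul_nonneg (by linarith) hG
  constructor <;> linarith

theorem rpow_le_sqrt_div {x : ℝ} (hx : 262144 ≤ x) {q : ℝ} (hq : q ≤ 1 / 2) :
    x ^ q ≤ √x * (8 : ℝ) ^ (6 * (q - 1 / 2)) := by
  have hx0 : 0 < x := by linarith
  have h1 : x ^ q = √x * x ^ (q - 1 / 2) := by
    rw [Real.sqrt_eq_rpow, ← Real.rpow_add hx0]; congr 1; ring
  rw [h1]
  refine mul_le_mul_of_nonneg_left ?_ (Real.sqrt_nonneg x)
  rw [Real.rpow_mul (by norm_num)]
  refine Real.rpow_le_rpow_of_nonpos (by positivity) ?_ (by linarith)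
  rw [show (6 : ℝ) = ((6 : ℕ) : ℝ) by norm_num, Real.rpow_natCast]
  norm_num
  linarith

theorem psi_sub_theta_le_sqrt {x : ℝ} (hx : 262144 ≤ x) :
    Chebyshev.psi x - Chebyshev.theta x ≤ 6.5 * √x := by
  have hx0 : 0 ≤ x := by linarith
  have h := Chebyshev.psi_sub_theta_le_psi_add_psi_add_psi x
  have b2 := Chebyshev.psi_le_const_mul_self (x := x ^ (2 : ℝ)⁻¹) (by positivity)
  have b3 := Chebyshev.psi_le_const_mul_self (x := x ^ (3 : ℝ)⁻¹) (by positivity)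
  have b5 := Chebyshev.psi_le_const_mul_self (x := x ^ (5 : ℝ)⁻¹) (by positivity)
  have e2 : x ^ (2 : ℝ)⁻¹ = √x := by rw [Real.sqrt_eq_rpow]; norm_num
  have e3 : x ^ (3 : ℝ)⁻¹ ≤ √x * (1 / 8) := by
    have := rpow_le_sqrt_div hx (q := (3 : ℝ)⁻¹) (by norm_num)
    rw [show (6 : ℝ) * ((3 : ℝ)⁻¹ - 1 / 2) = -1 by norm_num, Real.rpow_neg_one] at this
    linarith
  have e5 : x ^ (5 : ℝ)⁻¹ ≤ √x * (1 / 16) := by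
    have := rpow_le_sqrt_div hx (q := (5 : ℝ)⁻¹) (by norm_num)
    have h8 : (8 : ℝ) ^ (6 * ((5 : ℝ)⁻¹ - 1 / 2)) ≤ 1 / 16 := by
      calc (8 : ℝ) ^ (6 * ((5 : ℝ)⁻¹ - 1 / 2)) ≤ (8 : ℝ) ^ (-(4 / 3) : ℝ) :=
            Real.rpow_le_rpow_of_exponent_le (by norm_num) (by norm_num)
        _ = ((2 : ℝ) ^ (3 : ℝ)) ^ (-(4 / 3) : ℝ) := by
            norm_num
        _ = 1 / 16 := by
            rw [← Real.rpow_mul (by norm_num), show (3 : ℝ) * (-(4 / 3)) = -((4 : ℕ) : ℝ) by norm_num,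
              Real.rpow_neg (by norm_num), Real.rpow_natCast]
            norm_num
    exact this.trans (mul_le_mul_of_nonneg_left h8 (Real.sqrt_nonneg x))
  have h4 : Real.log 4 = 2 * Real.log 2 := by
    rw [show (4 : ℝ) = 2 ^ 2 by norm_num, Real.log_pow]; norm_num
  have := Real.log_two_lt_d9
  have hs : 0 ≤ √x := Real.sqrt_nonneg x
  rw [e2] at b2
  have hc : Real.log 4 + 4 ≤ 5.3863 := by rw [h4]; linarith
  have hc0 : 0 ≤ Real.log 4 + 4 := by rw [h4]; linarith [Real.log_two_gt_d9]
  have m3 := mul_le_mul_of_nonneg_left e3 hc0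
  have m5 := mul_le_mul_of_nonneg_left e5 hc0
  have ms := mul_le_mul_of_nonneg_right hc hs
  rw [e2] at h
  linarith

theorem sum_inv_le_log_sub {N t : ℕ} (hN : 1 ≤ N) (ht : N ≤ t) :
    ∑ m ∈ Ioc N t, (1 : ℝ) / m ≤ Real.log t - Real.log N := by
  induction t, ht using Nat.le_induction with
  | base => simp
  | succ k hk ih =>
    have hk0 : (0 : ℝ) < k := by exact_mod_cast (by omega : 0 < k)
    rw [Finset.sum_Ioc_succ_top hk]
    have u := sub_le_mul_log_sub hk0 (show (0 : ℝ) < k + 1 by linarith)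
    push_cast
    have : 1 / ((k : ℝ) + 1) ≤ Real.log ((k : ℝ) + 1) - Real.log k := by
      rw [div_le_iff₀ (by linarith)]; linarith
    linarith

theorem psi_sub_theta_succ (m : ℕ) :
    Chebyshev.psi ((m + 1 : ℕ) : ℝ) - Chebyshev.theta ((m + 1 : ℕ) : ℝ) =
      (Chebyshev.psi (m : ℝ) - Chebyshev.theta (m : ℝ)) +
        if (m + 1).Prime then 0 else ArithmeticFunction.vonMangoldt (m + 1) := by
  rw [Chebyshev.psi_sub_theta_eq_sum_not_prime, Chebyshev.psi_sub_theta_eq_sum_not_prime,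
    Nat.floor_natCast, Nat.floor_natCast, sum_filter, sum_filter, sum_Ioc_zero_succ]
  congr 1
  split_ifs <;> simp_all

theorem sum_vonMangoldt_not_prime_div_le {c : ℝ} (hc : 0 ≤ c) {N t : ℕ} (hN : 1 ≤ N) (ht : N ≤ t)
    (h : ∀ m : ℕ, N ≤ m → Chebyshev.psi m - Chebyshev.theta m ≤ c * √m) :
    ∑ d ∈ Ioc N t, (if d.Prime then 0 else ArithmeticFunction.vonMangoldt d) / (d : ℝ) ≤
      2 * c / √N := by
  have key : ∑ d ∈ Ioc N t, (if d.Prime then 0 else ArithmeticFunction.vonMangoldt d) / (d : ℝ) ≤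
      (Chebyshev.psi t - Chebyshev.theta t) / t + 2 * c * (1 / √N - 1 / √t) := by
    induction t, ht using Nat.le_induction with
    | base =>
      have := Chebyshev.theta_le_psi N
      simp only [Finset.Ioc_self, sum_empty, sub_self, mul_zero, add_zero]
      exact div_nonneg (by linarith) (by positivity)
    | succ k hk ih =>
      have hk0 : (0 : ℝ) < k := by exact_mod_cast (by omega : 0 < k)
      rw [Finset.sum_Ioc_succ_top hk]
      have hs := psi_sub_theta_succ k
      rw [hs]
      have hb := h k hk
      set w := (if (k + 1).Prime then 0 else ArithmeticFunction.vonMangoldt (k + 1))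
      set n := Chebyshev.psi (k : ℝ) - Chebyshev.theta (k : ℝ)
      push_cast
      set u := √(k : ℝ) with hu
      set v := √((k : ℝ) + 1) with hv
      have hu0 : 0 < u := Real.sqrt_pos.2 hk0
      have hv0 : 0 < v := Real.sqrt_pos.2 (by linarith)
      have hu2 : u ^ 2 = k := Real.sq_sqrt hk0.le
      have hv2 : v ^ 2 = (k : ℝ) + 1 := Real.sq_sqrt (by linarith)
      have huv : u ≤ v := Real.sqrt_le_sqrt (by linarith)
      have e1 : 1 / u - 1 / v = 1 / (u * v * (u + v)) := by
        have : (v - u) * (u + v) = 1 := by nlinarith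
        field_simp
        linarith
      have e2 : n / k - n / ((k : ℝ) + 1) = n / (u ^ 2 * v ^ 2) := by
        rw [hu2, hv2]; field_simp; ring
      have e3 : n / (u ^ 2 * v ^ 2) ≤ 2 * c * (1 / u - 1 / v) := by
        rw [e1, mul_one_div, div_le_div_iff₀ (by positivity) (by positivity)]
        calc n * (u * v * (u + v)) ≤ (c * u) * (u * v * (v + v)) := by
              refine mul_le_mul hb ?_ (by positivity) (by positivity)
              exact mul_le_mul_of_nonneg_left (by linarith) (by positivity)
          _ = _ := by ring
      rw [← e2] at e3
      rw [add_div]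
      have := ih
      linarith
  have hb := h t ht
  have ht0 : (0 : ℝ) < t := by exact_mod_cast (by omega : 0 < t)
  have hst : 0 < √(t : ℝ) := Real.sqrt_pos.2 ht0
  have : (Chebyshev.psi t - Chebyshev.theta t) / t ≤ c / √t := by
    rw [div_le_div_iff₀ ht0 hst]
    calc _ ≤ c * √t * √t := mul_le_mul_of_nonneg_right hb hst.le
      _ = _ := by rw [mul_assoc, Real.mul_self_sqrt ht0.le]
  have e : 2 * c * (1 / √(N : ℝ) - 1 / √(t : ℝ)) = 2 * c / √N - 2 * (c / √t) := by ring
  have : 0 ≤ c / √(t : ℝ) := by positivity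
  linarith

theorem sum_log_div_prime_ge {N t : ℕ} (hN : 394016 ≤ N) (ht : N ≤ t) :
    ∑ m ∈ Ioc N t, (1 : ℝ) / m - (Chebyshev.psi N / N - 0.8051) ≤
      ∑ p ∈ Ioc N t with p.Prime, Real.log p / p := by
  have hNr : (394016 : ℝ) ≤ N := by exact_mod_cast hN
  have htr : (N : ℝ) ≤ t := by exact_mod_cast ht
  have hA := (abs_le.1 (sumMangoldtDiv_approx N hN)).2
  have hB := (abs_le.1 (sumMangoldtDiv_approx t (by omega))).1
  have qA := (sum_mertensDefect_bounds N hN).2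
  have qB := (sum_mertensDefect_bounds t (by omega)).1
  have hT1 := Real.log_three_gt_d9
  have hA' : (∑ d ∈ Ioc 0 N, ArithmeticFunction.vonMangoldt d * mertensDefect N d) /
      (N * Real.log 3) ≤ 0.01876 := by
    rw [div_le_iff₀ (by nlinarith)]
    nlinarith
  have hB' : -0.07492 ≤ (∑ d ∈ Ioc 0 t, ArithmeticFunction.vonMangoldt d * mertensDefect t d) /
      (t * Real.log 3) := by
    rw [le_div_iff₀ (by nlinarith)]
    nlinarith
  have hψ : 0.9203 ≤ Chebyshev.psi t / t := by
    rw [le_div_iff₀ (by linarith)]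
    exact (psi_bounds (by linarith)).1
  have hlog := sum_inv_le_log_sub (show 1 ≤ N by omega) ht
  have hpp := sum_vonMangoldt_not_prime_div_le (c := 6.5) (by norm_num) (show 1 ≤ N by omega) ht
    fun m hm => psi_sub_theta_le_sqrt (by
      have : (394016 : ℝ) ≤ m := by exact_mod_cast hN.trans hm
      linarith)
  have hs : (627.7 : ℝ) ≤ √N := Real.le_sqrt_of_sq_le (by norm_num; linarith)
  have hpp' : 2 * (6.5 : ℝ) / √N ≤ 0.02072 := by
    rw [div_le_iff₀ (by linarith)]; linarith
  have hsplit : sumMangoldtDiv t = sumMangoldtDiv N + (∑ p ∈ Ioc N t with p.Prime, Real.log p / p +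
      ∑ d ∈ Ioc N t, (if d.Prime then 0 else ArithmeticFunction.vonMangoldt d) / (d : ℝ)) := by
    have h1 : sumMangoldtDiv t = sumMangoldtDiv N +
        ∑ d ∈ Ioc N t, ArithmeticFunction.vonMangoldt d / d :=
      (Finset.sum_Ioc_consecutive _ (Nat.zero_le N) ht).symm
    rw [h1, sum_filter, ← sum_add_distrib]
    congr 1
    refine sum_congr rfl fun d _ => ?_
    split_ifs with hp
    · rw [ArithmeticFunction.vonMangoldt_apply_prime hp]; simp
    · simp
  linarith

theorem integral_exp_neg_mul_log :
    MeasureTheory.IntegrableOn (fun v : ℝ => Real.exp (-v) * Real.log v) (Set.Ioi 0) ∧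
      ∫ v in Set.Ioi (0 : ℝ), Real.exp (-v) * Real.log v = -Real.eulerMascheroniConstant := by
  have h1 : (0 : ℝ) < (1 : ℂ).re := by simp
  have hd := Complex.hasDerivAt_GammaIntegral h1
  have hconv : MellinConvergent
      (fun t : ℝ => Real.log t • ((Real.exp (-t) : ℝ) : ℂ)) 1 := by
    refine (mellin_hasDerivAt_of_isBigO_rpow (E := ℂ) (a := 2) (b := 0) ?_ ?_ (by norm_num) ?_
      (by norm_num)).1
    · refine (Continuous.continuousOn ?_).locallyIntegrableOn measurableSet_Ioi
      exact Complex.continuous_ofReal.comp (Real.continuous_exp.comp continuous_neg)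
    · rw [← Asymptotics.isBigO_norm_left]
      simp_rw [Complex.norm_real, Asymptotics.isBigO_norm_left]
      simpa only [neg_one_mul] using (isLittleO_exp_neg_mul_rpow_atTop zero_lt_one _).isBigO
    · simp_rw [neg_zero, Real.rpow_zero]
      refine Asymptotics.isBigO_const_of_tendsto (?_ : Tendsto _ _ (nhds (1 : ℂ))) one_ne_zero
      rw [(by simp : (1 : ℂ) = Real.exp (-0))]
      exact (Complex.continuous_ofReal.comp
        (Real.continuous_exp.comp continuous_neg)).continuousWithinAt
  have hIntegrable : MeasureTheory.IntegrableOn (fun v : ℝ => Real.exp (-v) * Real.log v)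
      (Set.Ioi 0) := by
    have h := (MeasureTheory.Integrable.re hconv : MeasureTheory.Integrable _ _)
    refine MeasureTheory.Integrable.congr h (Eventually.of_forall fun v => ?_)
    have : (Complex.exp (-(v : ℂ))).re = Real.exp (-v) := by
      rw [← Complex.ofReal_neg, Complex.exp_ofReal_re]
    simp [mul_comm, this]
  refine ⟨hIntegrable, ?_⟩
  have hG : HasDerivAt Complex.GammaIntegral (-(Real.eulerMascheroniConstant : ℂ)) 1 := by
    refine Complex.hasDerivAt_Gamma_one.congr_of_eventuallyEq ?_
    have : {s : ℂ | 0 < s.re} ∈ nhds (1 : ℂ) :=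
      (isOpen_lt continuous_const Complex.continuous_re).mem_nhds h1
    filter_upwards [this] with s hs
    exact (Complex.Gamma_eq_integral hs).symm
  have h := hd.unique hG
  have h2 : ∫ t : ℝ in Set.Ioi 0, (t : ℂ) ^ ((1 : ℂ) - 1) * (Real.log t * Real.exp (-t)) =
      ((∫ v in Set.Ioi (0 : ℝ), Real.exp (-v) * Real.log v : ℝ) : ℂ) := by
    rw [← integral_complex_ofReal]
    congr 1
    ext v
    simp [mul_comm]
  rw [h2] at h
  exact_mod_cast h

theorem integrableOn_exp_neg_div {z : ℝ} (hz : 0 < z) :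
    MeasureTheory.IntegrableOn (fun v : ℝ => Real.exp (-v) / v) (Set.Ioi z) := by
  have h0 : MeasureTheory.IntegrableOn (fun v : ℝ => Real.exp (-v) * z⁻¹) (Set.Ioi z) :=
    (integrableOn_exp_neg_Ioi z).mul_const _
  refine MeasureTheory.Integrable.mono' h0 ?_ ?_
  · exact (ContinuousOn.div (by fun_prop) continuousOn_id
      (fun v hv => (hz.trans hv).ne')).aestronglyMeasurable measurableSet_Ioi
  · refine (MeasureTheory.ae_restrict_iff' measurableSet_Ioi).2 (Eventually.of_forall ?_)
    intro v hv
    have hv' : z < v := hv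
    rw [Real.norm_of_nonneg (by have := hz.trans hv'; positivity), div_eq_mul_inv]
    gcongr

/-- The exponential integral `∫_z^∞ e^{-v}/v dv`. -/
noncomputable def expInt (z : ℝ) : ℝ := ∫ v in Set.Ioi z, Real.exp (-v) / v

theorem neg_gamma_sub_log_le_expInt {z : ℝ} (hz : 0 < z) :
    -Real.eulerMascheroniConstant - Real.log z ≤ expInt z := by
  obtain ⟨hi, hg⟩ := integral_exp_neg_mul_log
  have hiz : MeasureTheory.IntegrableOn (fun v : ℝ => Real.exp (-v) * Real.log v) (Set.Ioi z) :=
    hi.mono_set (Set.Ioi_subset_Ioi hz.le)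
  have h1 : ∫ v in Set.Ioi z, (Real.exp (-v) / v - Real.exp (-v) * Real.log v) =
      0 - Real.exp (-z) * Real.log z := by
    refine MeasureTheory.integral_Ioi_of_hasDerivAt_of_tendsto'
      (f := fun v => Real.exp (-v) * Real.log v) ?_ ((integrableOn_exp_neg_div hz).sub hiz) ?_
    · intro x hx
      have hx0 : 0 < x := hz.trans_le hx
      have := ((hasDerivAt_neg x).exp).mul (Real.hasDerivAt_log hx0.ne')
      refine HasDerivAt.congr_deriv this ?_
      ring
    · have h := Real.tendsto_pow_mul_exp_neg_atTop_nhds_zero 1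
      refine squeeze_zero' ?_ ?_ h
      · filter_upwards [eventually_ge_atTop 1] with v hv
        have := Real.log_nonneg hv
        positivity
      · filter_upwards [eventually_ge_atTop 1] with v hv
        rw [mul_comm, pow_one]
        have := Real.log_le_sub_one_of_pos (by linarith : 0 < v)
        gcongr
        linarith
  rw [MeasureTheory.integral_sub (integrableOn_exp_neg_div hz) hiz] at h1
  have h2 := intervalIntegral.integral_Ioi_sub_Ioi hi hz.le
  have h3 : ∫ v in (0 : ℝ)..z, Real.exp (-v) * Real.log v ≤
      ∫ v in (0 : ℝ)..z, Real.exp (-v) * Real.log z := by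
    refine intervalIntegral.integral_mono_on_of_le_Ioo hz.le ?_ ?_ ?_
    · rw [intervalIntegrable_iff_integrableOn_Ioc_of_le hz.le]
      exact hi.mono_set Set.Ioc_subset_Ioi_self
    · exact (by fun_prop : Continuous fun v : ℝ =>
        Real.exp (-v) * Real.log z).intervalIntegrable _ _
    · intro v hv
      have := Real.log_le_log hv.1 hv.2.le
      gcongr
  have h4 : ∫ v in (0 : ℝ)..z, Real.exp (-v) * Real.log z =
      (1 - Real.exp (-z)) * Real.log z := by
    rw [intervalIntegral.integral_mul_const]
    congr 1
    rw [intervalIntegral.integral_comp_neg (fun v => Real.exp v)]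
    simp
  unfold expInt
  rw [h4] at h3
  linarith

theorem expInt_sub_le {a b : ℝ} (ha : 0 < a) (hab : a ≤ b) :
    expInt a - expInt b ≤ (b - a) * (Real.exp (-a) / a) := by
  unfold expInt
  rw [intervalIntegral.integral_Ioi_sub_Ioi (integrableOn_exp_neg_div ha) hab]
  have hc : ∫ v in a..b, Real.exp (-a) / a = (b - a) * (Real.exp (-a) / a) := by
    simp [mul_div_assoc]
  rw [← hc]
  refine intervalIntegral.integral_mono_on hab ?_ (by simp) ?_
  · rw [intervalIntegrable_iff_integrableOn_Ioc_of_le hab]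
    exact (integrableOn_exp_neg_div ha).mono_set Set.Ioc_subset_Ioi_self
  · intro v hv
    have := hv.1
    gcongr

theorem tendsto_expInt_atTop : Tendsto expInt atTop (nhds 0) := by
  have h := MeasureTheory.intervalIntegral_tendsto_integral_Ioi (1 : ℝ)
    (integrableOn_exp_neg_div one_pos) tendsto_id
  have h2 : Tendsto (fun z : ℝ => expInt 1 - ∫ v in (1 : ℝ)..z, Real.exp (-v) / v) atTop
      (nhds (expInt 1 - expInt 1)) := tendsto_const_nhds.sub h
  rw [sub_self] at h2
  refine h2.congr' ?_
  filter_upwards [eventually_ge_atTop 1] with z hz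
  unfold expInt
  rw [← intervalIntegral.integral_Ioi_sub_Ioi (integrableOn_exp_neg_div one_pos) hz]
  ring

theorem neg_le_sum_mul_of_antitone {N : ℕ} {a w : ℕ → ℝ} {η : ℝ}
    (hw : ∀ m ≥ N, w (m + 1) ≤ w m) (hw0 : ∀ m ≥ N, 0 ≤ w m)
    (hS : ∀ t ≥ N, -η ≤ ∑ m ∈ Ioc N t, a m) {t : ℕ} (ht : N ≤ t) :
    -(η * w N) ≤ ∑ m ∈ Ioc N t, w m * a m := by
  suffices h : w t * (∑ m ∈ Ioc N t, a m + η) - η * w N ≤ ∑ m ∈ Ioc N t, w m * a m by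
    have h1 := mul_nonneg (hw0 t ht) (by linarith [hS t ht] : 0 ≤ ∑ m ∈ Ioc N t, a m + η)
    linarith
  induction t, ht using Nat.le_induction with
  | base => simp; linarith
  | succ t ht ih =>
    rw [Finset.sum_Ioc_succ_top (by omega), Finset.sum_Ioc_succ_top (by omega)]
    have h1 := mul_nonneg (sub_nonneg.2 (hw t ht))
      (by linarith [hS t ht] : 0 ≤ ∑ m ∈ Ioc N t, a m + η)
    linarith

theorem expInt_mul_log_sub_le {σ : ℝ} (hσ : 0 < σ) {m : ℕ} (hm : 2 ≤ m) :
    expInt (σ * Real.log m) - expInt (σ * Real.log (m + 1 : ℕ)) ≤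
      (m : ℝ) ^ (-σ) / Real.log m * (1 / m) := by
  have hm0 : (0 : ℝ) < m := by positivity
  have hl : 0 < Real.log m := Real.log_pos (by exact_mod_cast hm)
  have hll : Real.log m ≤ Real.log (m + 1 : ℕ) := Real.log_le_log hm0 (by push_cast; linarith)
  have h := expInt_sub_le (mul_pos hσ hl) (mul_le_mul_of_nonneg_left hll hσ.le)
  have h2 : Real.exp (-(σ * Real.log m)) = (m : ℝ) ^ (-σ) := by
    rw [Real.rpow_def_of_pos hm0]; congr 1; ring
  rw [h2] at h
  refine h.trans ?_
  have h3 : Real.log (m + 1 : ℕ) - Real.log m ≤ 1 / m := by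
    rw [← Real.log_div (by positivity) hm0.ne']
    have := Real.log_le_sub_one_of_pos (x := ((m + 1 : ℕ) : ℝ) / m) (by positivity)
    refine this.trans (le_of_eq ?_)
    push_cast
    field_simp
    ring
  have h4 : (0 : ℝ) ≤ (m : ℝ) ^ (-σ) / Real.log m := by positivity
  calc (σ * Real.log (m + 1 : ℕ) - σ * Real.log m) * ((m : ℝ) ^ (-σ) / (σ * Real.log m))
      = (m : ℝ) ^ (-σ) / Real.log m * (Real.log (m + 1 : ℕ) - Real.log m) := by
        field_simp
    _ ≤ _ := by gcongr

theorem expInt_sub_expInt_le_sum {σ : ℝ} (hσ : 0 < σ) {N : ℕ} (hN : 2 ≤ N) {t : ℕ}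
    (ht : N ≤ t) :
    expInt (σ * Real.log (N + 1 : ℕ)) - expInt (σ * Real.log (t + 1 : ℕ)) ≤
      ∑ m ∈ Ioc N t, (m : ℝ) ^ (-σ) / Real.log m * (1 / m) := by
  induction t, ht using Nat.le_induction with
  | base => simp
  | succ t ht ih =>
    rw [Finset.sum_Ioc_succ_top (by omega)]
    have := expInt_mul_log_sub_le hσ (show 2 ≤ t + 1 by omega)
    linarith

/-- The multiplicative function `n ↦ n ^ (-s)` on the naturals, for `s ≠ 0`. -/
noncomputable def rpowNegHom (s : ℝ) (hs : s ≠ 0) : ℕ →*₀ ℝ where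
  toFun n := (n : ℝ) ^ (-s)
  map_zero' := by simp [Real.zero_rpow (neg_ne_zero.2 hs)]
  map_one' := by simp
  map_mul' m n := by simp [Real.mul_rpow]

theorem sum_neg_log_one_sub_rpow_le_log_tsum {s : ℝ} (hs : 1 < s) (t : ℕ) :
    ∑ p ∈ Ioc 0 t with p.Prime, -Real.log (1 - (p : ℝ) ^ (-s)) ≤
      Real.log (∑' n : ℕ, 1 / (n : ℝ) ^ s) := by
  have hs0 : s ≠ 0 := by positivity
  have hsum : Summable (fun n : ℕ => (n : ℝ) ^ (-s)) := by
    simpa [Real.rpow_neg] using Real.summable_nat_rpow_inv.2 hs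
  have hlt : ∀ p : ℕ, p.Prime → (p : ℝ) ^ (-s) < 1 := fun p hp =>
    Real.rpow_lt_one_of_one_lt_of_neg (by exact_mod_cast hp.one_lt) (by linarith)
  have h := EulerProduct.prod_filter_prime_geometric_eq_tsum_factoredNumbers
    (f := (rpowNegHom s hs0 : ℕ →* ℝ)) hsum (Ioc 0 t)
  have h1 : ∏ p ∈ Ioc 0 t with p.Prime, (1 - (p : ℝ) ^ (-s))⁻¹ ≤ ∑' n : ℕ, 1 / (n : ℝ) ^ s := by
    have h2 : ∏ p ∈ Ioc 0 t with p.Prime, (1 - (p : ℝ) ^ (-s))⁻¹ =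
        ∑' m : Nat.factoredNumbers (Ioc 0 t), ((m : ℕ) : ℝ) ^ (-s) := h
    rw [h2]
    have h3 : ∑' n : ℕ, 1 / (n : ℝ) ^ s = ∑' n : ℕ, (n : ℝ) ^ (-s) := by
      congr 1; ext n; rw [Real.rpow_neg (by positivity), one_div]
    rw [h3]
    exact hsum.tsum_subtype_le _ _ (fun n => by positivity)
  have hpos : ∀ p ∈ (Ioc 0 t).filter Nat.Prime, (0 : ℝ) < (1 - (p : ℝ) ^ (-s))⁻¹ := by
    intro p hp
    have := hlt p (mem_filter.1 hp).2
    exact inv_pos.2 (by linarith)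
  have h4 : ∑ p ∈ Ioc 0 t with p.Prime, -Real.log (1 - (p : ℝ) ^ (-s)) =
      Real.log (∏ p ∈ Ioc 0 t with p.Prime, (1 - (p : ℝ) ^ (-s))⁻¹) := by
    rw [Real.log_prod (fun p hp => (hpos p hp).ne')]
    exact sum_congr rfl fun p hp => by rw [Real.log_inv]
  rw [h4]
  exact Real.log_le_log (prod_pos hpos) h1

theorem sum_neg_log_one_sub_rpow_le {σ η : ℝ} (hσ : 0 < σ) {N : ℕ} (hN : 2 ≤ N)
    (h : ∀ t ≥ N, ∑ m ∈ Ioc N t, (1 : ℝ) / m - η ≤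
      ∑ p ∈ Ioc N t with p.Prime, Real.log p / p) :
    ∑ p ∈ Ioc 0 N with p.Prime, -Real.log (1 - (p : ℝ) ^ (-(1 + σ))) ≤
      Real.log (σ * ∑' n : ℕ, 1 / (n : ℝ) ^ (1 + σ)) + Real.eulerMascheroniConstant +
        Real.log (Real.log (N + 1 : ℕ)) + η / Real.log N := by
  have hη : 0 ≤ η := by simpa using h N le_rfl
  have hlN : 0 < Real.log N := Real.log_pos (by exact_mod_cast hN)
  have hlN1 : 0 < Real.log (N + 1 : ℕ) := Real.log_pos (by exact_mod_cast (by omega : 1 < N + 1))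
  have htail : ∀ t ≥ N, expInt (σ * Real.log (N + 1 : ℕ)) - expInt (σ * Real.log (t + 1 : ℕ)) -
      η / Real.log N ≤ ∑ p ∈ Ioc N t with p.Prime, (p : ℝ) ^ (-(1 + σ)) := by
    intro t ht
    have hab := neg_le_sum_mul_of_antitone (N := N)
      (a := fun m => (if m.Prime then Real.log m / m else 0) - 1 / m)
      (w := fun m => (m : ℝ) ^ (-σ) / Real.log m) (η := η) ?_ ?_ ?_ ht
    · have h1 := expInt_sub_expInt_le_sum hσ hN ht
      have h2 : η * ((N : ℝ) ^ (-σ) / Real.log N) ≤ η / Real.log N := by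
        rw [← mul_div_assoc]
        gcongr
        have : (N : ℝ) ^ (-σ) ≤ 1 := Real.rpow_le_one_of_one_le_of_nonpos
          (by exact_mod_cast (by omega : 1 ≤ N)) (by linarith)
        nlinarith
      have h3 : ∑ m ∈ Ioc N t, (m : ℝ) ^ (-σ) / Real.log m *
          ((if m.Prime then Real.log m / m else 0) - 1 / m) =
          ∑ p ∈ Ioc N t with p.Prime, (p : ℝ) ^ (-(1 + σ)) -
            ∑ m ∈ Ioc N t, (m : ℝ) ^ (-σ) / Real.log m * (1 / m) := by
        rw [sum_filter, ← sum_sub_distrib]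
        refine sum_congr rfl fun m hm => ?_
        have hm2 : 2 ≤ m := by have := mem_Ioc.1 hm; omega
        have hm0 : (0 : ℝ) < m := by positivity
        have hl : 0 < Real.log m := Real.log_pos (by exact_mod_cast hm2)
        rw [mul_sub]
        congr 1
        split_ifs
        · rw [neg_add, Real.rpow_add hm0, Real.rpow_neg_one]
          field_simp
        · simp
      rw [h3] at hab
      linarith
    · intro m hm
      have hm2 : 2 ≤ m := by omega
      have hl : 0 < Real.log m := Real.log_pos (by exact_mod_cast hm2)
      have hm0 : (0 : ℝ) < m := by positivity
      have hle : (m : ℝ) ≤ (m + 1 : ℕ) := by push_cast; linarith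
      have := Real.log_le_log hm0 hle
      have h2 := Real.rpow_le_rpow_of_nonpos hm0 hle (by linarith : -σ ≤ 0)
      show ((m + 1 : ℕ) : ℝ) ^ (-σ) / Real.log (m + 1 : ℕ) ≤ _
      gcongr
    · intro m hm
      have hl : 0 ≤ Real.log m := Real.log_natCast_nonneg m
      positivity
    · intro t ht
      rw [sum_sub_distrib, ← sum_filter]
      linarith [h t ht]
  have hall : ∀ t ≥ N, ∑ p ∈ Ioc 0 N with p.Prime, -Real.log (1 - (p : ℝ) ^ (-(1 + σ))) +
      (expInt (σ * Real.log (N + 1 : ℕ)) - expInt (σ * Real.log (t + 1 : ℕ)) -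
      η / Real.log N) ≤ Real.log (∑' n : ℕ, 1 / (n : ℝ) ^ (1 + σ)) := by
    intro t ht
    have h1 := sum_neg_log_one_sub_rpow_le_log_tsum (s := 1 + σ) (by linarith) t
    have h2 : ∑ p ∈ Ioc 0 t with p.Prime, -Real.log (1 - (p : ℝ) ^ (-(1 + σ))) =
        ∑ p ∈ Ioc 0 N with p.Prime, -Real.log (1 - (p : ℝ) ^ (-(1 + σ))) +
        ∑ p ∈ Ioc N t with p.Prime, -Real.log (1 - (p : ℝ) ^ (-(1 + σ))) := by
      simp only [sum_filter]
      rw [sum_Ioc_consecutive _ (Nat.zero_le N) ht]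
    have h3 : ∑ p ∈ Ioc N t with p.Prime, (p : ℝ) ^ (-(1 + σ)) ≤
        ∑ p ∈ Ioc N t with p.Prime, -Real.log (1 - (p : ℝ) ^ (-(1 + σ))) := by
      refine sum_le_sum fun p hp => ?_
      have hp' := (mem_filter.1 hp).2
      have hlt : (p : ℝ) ^ (-(1 + σ)) < 1 :=
        Real.rpow_lt_one_of_one_lt_of_neg (by exact_mod_cast hp'.one_lt) (by linarith)
      have := Real.log_le_sub_one_of_pos (by linarith : 0 < 1 - (p : ℝ) ^ (-(1 + σ)))
      linarith
    linarith [htail t ht]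
  have hlim : Tendsto (fun t : ℕ => expInt (σ * Real.log (t + 1 : ℕ))) atTop (nhds 0) := by
    refine tendsto_expInt_atTop.comp (Tendsto.const_mul_atTop hσ ?_)
    exact Real.tendsto_log_atTop.comp (tendsto_natCast_atTop_atTop.comp (tendsto_add_atTop_nat 1))
  have hfin := le_of_tendsto ((((tendsto_const_nhds (x := expInt (σ * Real.log (N + 1 : ℕ)))).sub
    hlim).sub_const (η / Real.log N)).const_add
    (∑ p ∈ Ioc 0 N with p.Prime, -Real.log (1 - (p : ℝ) ^ (-(1 + σ)))))
    (eventually_atTop.2 ⟨N, hall⟩)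
  have hE := neg_gamma_sub_log_le_expInt (mul_pos hσ hlN1)
  rw [Real.log_mul hσ.ne' hlN1.ne'] at hE
  have hpos : 0 < ∑' n : ℕ, 1 / (n : ℝ) ^ (1 + σ) := by
    have hsum : Summable (fun n : ℕ => 1 / (n : ℝ) ^ (1 + σ)) :=
      Real.summable_one_div_nat_rpow.2 (by linarith)
    exact hsum.tsum_pos (fun n => by positivity) 1 (by simp)
  rw [Real.log_mul hσ.ne' hpos.ne']
  linarith

theorem sum_neg_log_one_sub_inv_le {η : ℝ} {N : ℕ} (hN : 2 ≤ N)
    (h : ∀ t ≥ N, ∑ m ∈ Ioc N t, (1 : ℝ) / m - η ≤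
      ∑ p ∈ Ioc N t with p.Prime, Real.log p / p) :
    ∑ p ∈ Ioc 0 N with p.Prime, -Real.log (1 - (p : ℝ)⁻¹) ≤
      Real.eulerMascheroniConstant + Real.log (Real.log (N + 1 : ℕ)) + η / Real.log N := by
  have hshift : Tendsto (fun σ : ℝ => 1 + σ) (nhdsWithin 0 (Set.Ioi 0))
      (nhdsWithin 1 (Set.Ioi 1)) := by
    refine tendsto_nhdsWithin_of_tendsto_nhds_of_eventually_within _ ?_ ?_
    · have : Tendsto (fun σ : ℝ => 1 + σ) (nhds 0) (nhds (1 + 0)) :=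
        (continuous_const.add continuous_id).tendsto 0
      rw [add_zero] at this
      exact this.mono_left nhdsWithin_le_nhds
    · filter_upwards [self_mem_nhdsWithin] with σ hσ
      have : 0 < σ := hσ
      simp [this]
  have hz : Tendsto (fun σ : ℝ => σ * ∑' n : ℕ, 1 / (n : ℝ) ^ (1 + σ))
      (nhdsWithin 0 (Set.Ioi 0)) (nhds 1) := by
    refine (tendsto_sub_mul_tsum_nat_rpow.comp hshift).congr fun σ => ?_
    simp
  have hlog := hz.log one_ne_zero
  rw [Real.log_one] at hlog
  have hR := ((hlog.add_const Real.eulerMascheroniConstant).add_const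
    (Real.log (Real.log (N + 1 : ℕ)))).add_const (η / Real.log N)
  rw [zero_add] at hR
  have hL : Tendsto (fun σ : ℝ => ∑ p ∈ Ioc 0 N with p.Prime,
      -Real.log (1 - (p : ℝ) ^ (-(1 + σ)))) (nhdsWithin 0 (Set.Ioi 0))
      (nhds (∑ p ∈ Ioc 0 N with p.Prime, -Real.log (1 - (p : ℝ)⁻¹))) := by
    refine tendsto_finsetSum _ fun p hp => ?_
    have hp' := (mem_filter.1 hp).2
    have hp1 : (1 : ℝ) < p := by exact_mod_cast hp'.one_lt
    have hc : ContinuousAt (fun σ : ℝ => (p : ℝ) ^ (-(1 + σ))) 0 :=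
      (Real.continuous_const_rpow (by linarith)).continuousAt.comp (by fun_prop)
    have ht := hc.tendsto
    rw [add_zero, Real.rpow_neg_one] at ht
    refine ((ht.const_sub 1).log ?_).neg.mono_left nhdsWithin_le_nhds
    have := inv_lt_one_of_one_lt₀ hp1
    linarith
  exact le_of_tendsto_of_tendsto hL hR (by
    filter_upwards [self_mem_nhdsWithin] with σ hσ
    exact sum_neg_log_one_sub_rpow_le hσ hN h)

theorem log_ge_of_large {x : ℝ} (hx : 394016 ≤ x) : 12.883 ≤ Real.log x := by
  have h2 := Real.log_two_gt_d9
  have h3 := Real.log_three_gt_d9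
  have h5 := Real.log_five_gt_d9
  have h : Real.log ((2 : ℝ) ^ 2 * 3 ^ 9 * 5) ≤ Real.log x :=
    Real.log_le_log (by norm_num) (by norm_num; linarith)
  rw [Real.log_mul (by norm_num) (by norm_num), Real.log_mul (by norm_num) (by norm_num),
    Real.log_pow, Real.log_pow] at h
  push_cast at h
  linarith

theorem sum_neg_log_one_sub_inv_lt {N : ℕ} (hN : 394016 ≤ N) :
    ∑ p ∈ Ioc 0 N with p.Prime, -Real.log (1 - (p : ℝ)⁻¹) - 0.01714 <
      Real.eulerMascheroniConstant + Real.log (Real.log (Chebyshev.theta N)) := by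
  have hNR : (394016 : ℝ) ≤ N := by exact_mod_cast hN
  have hN0 : (0 : ℝ) < N := by linarith
  have hL := log_ge_of_large hNR
  have hL0 : 0 < Real.log N := by linarith
  have hmert := sum_neg_log_one_sub_inv_le (by omega : 2 ≤ N)
    (fun t ht => sum_log_div_prime_ge hN ht)
  obtain ⟨hψ1, hψ2⟩ := psi_bounds (x := N) (by linarith)
  have hψθ := psi_sub_theta_le_sqrt (x := N) (by linarith)
  have hθψ := Chebyshev.theta_le_psi (N : ℝ)
  have hsqrt : 6.5 * √(N : ℝ) ≤ 0.01036 * N := by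
    have h1 : (627.6 : ℝ) ≤ √(N : ℝ) := Real.le_sqrt_of_sq_le (by norm_num; linarith)
    have h2 := Real.mul_self_sqrt hN0.le
    nlinarith
  obtain ⟨w, hw⟩ : ∃ w, w = Chebyshev.theta N / N := ⟨_, rfl⟩
  obtain ⟨r, hr⟩ : ∃ r, r = Chebyshev.psi N / N := ⟨_, rfl⟩
  have hθ : Chebyshev.theta N = w * N := by rw [hw]; field_simp
  have hψ : Chebyshev.psi N = r * N := by rw [hr]; field_simp
  rw [← hr] at hmert
  rw [hθ, hψ] at hψθ
  rw [hψ] at hψ1 hψ2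
  rw [hθ, hψ] at hθψ
  have hrl : 0.9203 ≤ r := le_of_mul_le_mul_right hψ1 hN0
  have hru : r ≤ 1.1127 := le_of_mul_le_mul_right hψ2 hN0
  have hwr : w ≤ r := le_of_mul_le_mul_right hθψ hN0
  have hrw : r - w ≤ 0.01036 :=
    le_of_mul_le_mul_right (by rw [sub_mul]; linarith) hN0
  have hw0 : 0 < w := by linarith
  have hlogθ : Real.log (Chebyshev.theta N) = Real.log N + Real.log w := by
    rw [hθ, Real.log_mul hw0.ne' hN0.ne', add_comm]
  obtain ⟨L, hLdef⟩ : ∃ L, L = Real.log N := ⟨_, rfl⟩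
  obtain ⟨l, hl⟩ : ∃ l, l = Real.log w := ⟨_, rfl⟩
  rw [hlogθ, ← hLdef, ← hl]
  rw [← hLdef] at hL hL0 hmert
  have hlu : l ≤ 0.1127 := by
    rw [hl]; linarith [Real.log_le_sub_one_of_pos hw0]
  have hll : 1 - 1 / w ≤ l := by
    rw [hl, one_div]; exact Real.one_sub_inv_le_log_of_pos hw0
  have hwinv : w + 1 / w ≤ 2.0116 := by
    rw [← sub_nonneg]
    have : 2.0116 - (w + 1 / w) = (2.0116 * w - w ^ 2 - 1) / w := by field_simp; ring
    rw [this]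
    refine div_nonneg ?_ hw0.le
    nlinarith [mul_nonneg (by linarith : 0 ≤ w - 0.9099) (by linarith : 0 ≤ 1.1127 - w)]
  have hl1 : -0.1 ≤ l := by
    have : 1 / w ≤ 1.1 := by rw [div_le_iff₀ hw0]; linarith
    linarith
  have hsucc : Real.log (Real.log (N + 1 : ℕ)) ≤ Real.log L + 1 / (N * L) := by
    have h1 : Real.log (N + 1 : ℕ) ≤ L + 1 / N := by
      have := Real.log_le_sub_one_of_pos (x := ((N + 1 : ℕ) : ℝ) / N) (by positivity)
      rw [Real.log_div (by positivity) hN0.ne', ← hLdef] at this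
      have h2 : ((N + 1 : ℕ) : ℝ) / N - 1 = 1 / N := by push_cast; field_simp; ring
      linarith
    have h0 : 0 < Real.log (N + 1 : ℕ) := Real.log_pos (by exact_mod_cast (by omega : 1 < N + 1))
    have h3 := Real.log_le_log h0 h1
    have h4 : L + 1 / N = L * (1 + 1 / (N * L)) := by field_simp
    rw [h4, Real.log_mul hL0.ne' (by positivity)] at h3
    have := Real.log_le_sub_one_of_pos (x := 1 + 1 / (N * L)) (by positivity)
    linarith
  have hll2 : Real.log L + (1 - L / (L + l)) ≤ Real.log (L + l) := by
    have := Real.one_sub_inv_le_log_of_pos (x := (L + l) / L) (by apply div_pos <;> linarith)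
    rw [Real.log_div (by linarith) hL0.ne', inv_div] at this
    linarith
  have hkey : 1 / (N * L) + (r - 0.8051) / L - 0.01714 < 1 - L / (L + l) := by
    have hLl : 0 < L + l := by linarith
    have h1 : (1 : ℝ) / N ≤ 0.00001 := by
      rw [div_le_iff₀ hN0]; linarith
    have h2 : l - l ^ 2 / (L + l) = L * (1 - L / (L + l)) := by field_simp; ring
    have h3 : l ^ 2 / (L + l) ≤ 0.00101 := by
      rw [div_le_iff₀ hLl]; nlinarith
    have h4 : 1 / (N * L) + (r - 0.8051) / L = (1 / N + (r - 0.8051)) / L := by field_simp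
    rw [h4, sub_lt_iff_lt_add, div_lt_iff₀ hL0]
    have : (1 - L / (L + l) + 0.01714) * L = l - l ^ 2 / (L + l) + 0.01714 * L := by
      rw [h2]; ring
    rw [this]
    linarith
  linarith

/-- State of a sieve over the integers prime to `6`, with fixed-point (denominator `2 ^ 60`) bounds:
`c` is the current integer, `n` the number of primes up to `c`, `p` a prime up to `c`, `l` a lower
bound for `log p`, `t` for `θ(c)`, `lam` for `log θ(c)`, and `u` is an upper bound for
`∏_{p ≤ c} (1 - 1/p)⁻¹`; `ok` records that all checks so far succeeded. -/
structure SieveState where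
  c : ℕ
  n : ℕ
  p : ℕ
  l : ℕ
  t : ℕ
  lam : ℕ
  u : ℕ
  ok : Bool

/-- Evaluate `n` before passing it on. -/
noncomputable def force {α : Type} (n : ℕ) (k : ℕ → α) : α :=
  Nat.rec (k 0) (fun m _ => k (Nat.succ m)) n

/-- Evaluate a state before passing it on. -/
noncomputable def forceState (s : SieveState) (k : SieveState → SieveState) : SieveState :=
  SieveState.rec (fun c n p l t lam u ok => k ⟨c, n, p, l, t, lam, u, ok⟩) s

/-- Branch on a Boolean, by the recursor. -/
noncomputable def branch {α : Type} (b : Bool) (x y : α) : α := Bool.rec y x b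

/-- The checks made at a prime `p`, the `n`-th one. -/
noncomputable def sieveCheck (n p l lam u : ℕ) (ok : Bool) : Bool :=
  branch (Nat.ble n 508) ok
    (branch (Nat.ble 3637 p)
      (branch (Nat.ble 9451091000000000000 l)
        (branch (Nat.ble 9430904000000000000 lam)
          (branch (Nat.ble (Nat.mul 983 u) (Nat.mul 1773 lam)) ok false) false) false) false)

/-- Update the state at a new prime `c`. -/
noncomputable def sieveAdd (c n p l t lam u : ℕ) (ok : Bool) : SieveState :=
  force (Nat.add l (Nat.div (Nat.mul 2305843009213693952 (Nat.sub c p)) (Nat.add c p))) fun l' =>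
  force (Nat.add t l') fun t' =>
  force (Nat.add lam (Nat.div (Nat.mul 2305843009213693952 l') (Nat.add t t'))) fun lam' =>
  force (Nat.succ (Nat.div (Nat.mul u c) (Nat.sub c 1))) fun u' =>
  force (Nat.succ n) fun n' =>
  branch (sieveCheck n' c l' lam' u' ok) ⟨c, n', c, l', t', lam', u', true⟩
    ⟨c, n', c, l', t', lam', u', false⟩

/-- Move on by `d`, testing primality by coprimality to `F`. -/
noncomputable def sieveStep (F d : ℕ) (s : SieveState) : SieveState :=
  SieveState.rec (fun c n p l t lam u ok =>
    force (Nat.add c d) fun c' =>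
      branch (Nat.beq (Nat.gcd c' F) 1) (sieveAdd c' n p l t lam u ok)
        ⟨c', n, p, l, t, lam, u, ok⟩) s

/-- Iterate `f` for `2 ^ k` times. -/
noncomputable def iterTwoPow (f : SieveState → SieveState) (k : ℕ) : SieveState → SieveState :=
  Nat.rec f (fun _ g s => forceState (g s) g) k

/-- `2 ^ k` rounds of the sieve, each advancing by `6`. -/
noncomputable def sieveRun (M k : ℕ) (s : SieveState) : SieveState :=
  force (Nat.factorial M) fun F => iterTwoPow (fun s => sieveStep F 2 (sieveStep F 4 s)) k s

/-- Boolean equality of states with `ok` set. -/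
noncomputable def SieveState.eqOk (s r : SieveState) : Bool :=
  SieveState.rec (fun c n p l t lam u ok =>
    branch ok (branch (Nat.beq c r.c) (branch (Nat.beq n r.n) (branch (Nat.beq p r.p)
      (branch (Nat.beq l r.l) (branch (Nat.beq t r.t) (branch (Nat.beq lam r.lam)
        (Nat.beq u r.u) false) false) false) false) false) false) false) s

/-- Sieve state at `31`. -/
noncomputable def sieveState31 : SieveState :=
  ⟨31, 11, 31, 3959116541674170499, 30004068192997398768,
    3757409021472604015, 7542723436537264518, true⟩

/-- Sieve state at `799`. -/
noncomputable def sieveState799 : SieveState :=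
  ⟨799, 139, 797, 7700899096039504241, 874985868874048624636,
    7644940484224455598, 13785153360894253495, true⟩

/-- Sieve state at `49951`. -/
noncomputable def sieveState49951 : SieveState :=
  ⟨49951, 5129, 49943, 12471426236635010251, 57278975749361531244963,
    12465855758316847005, 22224317081984901239, true⟩

/-- Sieve state at `99103`. -/
noncomputable def sieveState99103 : SieveState :=
  ⟨99103, 9514, 99103, 13261497233658975819, 113879181384823345794116,
    13258148525351520120, 23629735007679387066, true⟩

/-- Sieve state at `148255`. -/
noncomputable def sieveState148255 : SieveState :=
  ⟨148255, 13695, 148249, 13725817436360072475, 170356368472334593157733,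
    13722492796141386556, 24454174072473676454, true⟩

/-- Sieve state at `197407`. -/
noncomputable def sieveState197407 : SieveState :=
  ⟨197407, 17773, 197389, 14055879388062405320, 227033315174702126082983,
    14053616742305351501, 25042381631156599106, true⟩

/-- Sieve state at `246559`. -/
noncomputable def sieveState246559 : SieveState :=
  ⟨246559, 21756, 246557, 14312308503028014600, 283546129021492615302132,
    14309885889466127617, 25497806271517737301, true⟩

/-- Sieve state at `295711`. -/
noncomputable def sieveState295711 : SieveState :=
  ⟨295711, 25664, 295703, 14521866245851659776, 339897254239999559345141,
    14518874305749140382, 25869280775800293407, true⟩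

/-- Sieve state at `344863`. -/
noncomputable def sieveState344863 : SieveState :=
  ⟨344863, 29568, 344863, 14699175962986493437, 396944500685326267846550,
    14697753646176127968, 26187241681956250461, true⟩

/-- Sieve state at `394015`. -/
noncomputable def sieveState394015 : SieveState :=
  ⟨394015, 33401, 394007, 14852769824732016414, 453587908481868109391795,
    14851544867605585277, 26460730897813187163, true⟩

theorem sieveRun_state31 :
    (sieveRun 31 7 sieveState31).eqOk sieveState799 = true := by
  decide +kernel

theorem sieveRun_state799 :
    (sieveRun 631 13 sieveState799).eqOk sieveState49951 = true := by
  decide +kernel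

theorem sieveRun_state49951 :
    (sieveRun 631 13 sieveState49951).eqOk sieveState99103 = true := by
  decide +kernel

theorem sieveRun_state99103 :
    (sieveRun 631 13 sieveState99103).eqOk sieveState148255 = true := by
  decide +kernel

theorem sieveRun_state148255 :
    (sieveRun 631 13 sieveState148255).eqOk sieveState197407 = true := by
  decide +kernel

theorem sieveRun_state197407 :
    (sieveRun 631 13 sieveState197407).eqOk sieveState246559 = true := by
  decide +kernel

theorem sieveRun_state246559 :
    (sieveRun 631 13 sieveState246559).eqOk sieveState295711 = true := by
  decide +kernel

theorem sieveRun_state295711 :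
    (sieveRun 631 13 sieveState295711).eqOk sieveState344863 = true := by
  decide +kernel

theorem sieveRun_state344863 :
    (sieveRun 631 13 sieveState344863).eqOk sieveState394015 = true := by
  decide +kernel

@[simp] theorem branch_true {α : Type} (x y : α) : branch true x y = x := rfl

@[simp] theorem branch_false {α : Type} (x y : α) : branch false x y = y := rfl

theorem force_eq {α : Type} (n : ℕ) (k : ℕ → α) : force n k = k n := by
  cases n <;> rfl

theorem forceState_eq (s : SieveState) (k : SieveState → SieveState) : forceState s k = k s := by
  cases s; rfl

/-- The product `∏_{p ≤ c} (1 - 1/p)⁻¹`. -/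
noncomputable def primeProd (c : ℕ) : ℝ := ∏ p ∈ Ioc 0 c with p.Prime, (1 - (p : ℝ)⁻¹)⁻¹

/-- What the sieve checks at a prime `q`. -/
structure SieveGood (q : ℕ) : Prop where
  le_self : 3637 ≤ q
  le_log : (9451091000000000000 : ℝ) ≤ 2 ^ 60 * Real.log q
  le_log_theta : (9430904000000000000 : ℝ) ≤ 2 ^ 60 * Real.log (Chebyshev.theta q)
  prod_le : 983 * primeProd q ≤ 1773 * Real.log (Chebyshev.theta q)

/-- Correctness of a state of the sieve. -/
structure SieveState.Sound (s : SieveState) : Prop where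
  le_p : 31 ≤ s.p
  p_le : s.p ≤ s.c
  card_eq : ((Ioc 0 s.c).filter Nat.Prime).card = s.n
  l_le : (s.l : ℝ) ≤ 2 ^ 60 * Real.log s.p
  t_pos : 0 < s.t
  t_le : (s.t : ℝ) ≤ 2 ^ 60 * Chebyshev.theta s.c
  lam_le : (s.lam : ℝ) ≤ 2 ^ 60 * Real.log (s.t / 2 ^ 60)
  le_u : 2 ^ 60 * primeProd s.c ≤ s.u
  good : s.ok = true → ∀ q ≤ s.c, q.Prime → 509 ≤ ((Ioc 0 q).filter Nat.Prime).card → SieveGood q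

theorem theta_natCast (c : ℕ) :
    Chebyshev.theta c = ∑ p ∈ Ioc 0 c with p.Prime, Real.log p := by
  simp [Chebyshev.theta]

theorem two_mul_sub_div_le_log_sub {a b : ℝ} (ha : 0 < a) (hab : a ≤ b) :
    2 * (b - a) / (b + a) ≤ Real.log b - Real.log a := by
  have hx : 0 ≤ (b - a) / a := div_nonneg (by linarith) ha.le
  have h := Real.le_log_one_add_of_nonneg hx
  rw [← Real.log_div (by linarith) ha.ne']
  have h1 : 1 + (b - a) / a = b / a := by field_simp; ring
  have h2 : 2 * ((b - a) / a) / ((b - a) / a + 2) = 2 * (b - a) / (b + a) := by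
    have : b + a ≠ 0 := by linarith
    have : (b - a) / a + 2 = (b + a) / a := by field_simp; ring
    rw [this]
    field_simp
  rwa [h1, h2] at h

theorem filter_prime_Ioc_of_not_prime {c c' : ℕ} (hc : c ≤ c')
    (h : ∀ q, q.Prime → c < q → ¬ q ≤ c') :
    (Ioc 0 c').filter Nat.Prime = (Ioc 0 c).filter Nat.Prime := by
  ext q
  simp only [mem_filter, mem_Ioc]
  constructor
  · rintro ⟨⟨h1, h2⟩, h3⟩
    exact ⟨⟨h1, by by_contra h4; exact h q h3 (by omega) h2⟩, h3⟩
  · rintro ⟨⟨h1, h2⟩, h3⟩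
    exact ⟨⟨h1, by omega⟩, h3⟩

theorem filter_prime_Ioc_of_prime {c c' : ℕ} (hc : c < c') (hp : c'.Prime)
    (h : ∀ q, q.Prime → c < q → ¬ q < c') :
    (Ioc 0 c').filter Nat.Prime = insert c' ((Ioc 0 c).filter Nat.Prime) := by
  ext q
  simp only [mem_filter, mem_Ioc, mem_insert]
  constructor
  · rintro ⟨⟨h1, h2⟩, h3⟩
    rcases h2.eq_or_lt with h2 | h2
    · exact Or.inl h2
    · exact Or.inr ⟨⟨h1, by by_contra h4; exact h q h3 (by omega) h2⟩, h3⟩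
  · rintro (rfl | ⟨⟨h1, h2⟩, h3⟩)
    · exact ⟨⟨by omega, le_rfl⟩, hp⟩
    · exact ⟨⟨h1, by omega⟩, h3⟩

theorem sieveCheck_eq_true {n p l lam u : ℕ} {ok : Bool}
    (h : sieveCheck n p l lam u ok = true) :
    ok = true ∧ (509 ≤ n → 3637 ≤ p ∧ 9451091000000000000 ≤ l ∧ 9430904000000000000 ≤ lam ∧
      983 * u ≤ 1773 * lam) := by
  unfold sieveCheck at h
  rcases h0 : Nat.ble n 508 with _ | _
  · rw [h0, branch_false] at h
    rcases h1 : Nat.ble 3637 p with _ | _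
    · simp [h1] at h
    rcases h2 : Nat.ble 9451091000000000000 l with _ | _
    · simp [h1, h2] at h
    rcases h3 : Nat.ble 9430904000000000000 lam with _ | _
    · simp [h1, h2, h3] at h
    rcases h4 : Nat.ble (Nat.mul 983 u) (Nat.mul 1773 lam) with _ | _
    · rw [h1, h2, h3, h4] at h
      simp at h
    rw [h1, h2, h3, h4] at h
    exact ⟨h, fun _ => ⟨Nat.le_of_ble_eq_true h1, Nat.le_of_ble_eq_true h2,
      Nat.le_of_ble_eq_true h3, Nat.le_of_ble_eq_true h4⟩⟩
  · rw [h0, branch_true] at h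
    exact ⟨h, fun h5 => by have := Nat.le_of_ble_eq_true h0; omega⟩

theorem sieveAdd_eq (c n p l t lam u : ℕ) (ok : Bool) :
    ∃ b : Bool, sieveAdd c n p l t lam u ok =
      ⟨c, n + 1, c, l + 2305843009213693952 * (c - p) / (c + p),
        t + (l + 2305843009213693952 * (c - p) / (c + p)),
        lam + 2305843009213693952 * (l + 2305843009213693952 * (c - p) / (c + p)) /
          (t + (t + (l + 2305843009213693952 * (c - p) / (c + p)))),
        u * c / (c - 1) + 1, b⟩ ∧
      (b = true → sieveCheck (n + 1) c (l + 2305843009213693952 * (c - p) / (c + p))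
        (lam + 2305843009213693952 * (l + 2305843009213693952 * (c - p) / (c + p)) /
          (t + (t + (l + 2305843009213693952 * (c - p) / (c + p)))))
        (u * c / (c - 1) + 1) ok = true) := by
  unfold sieveAdd
  have hdiv : ∀ a b : ℕ, Nat.div a b = a / b := fun _ _ => rfl
  simp only [force_eq, Nat.add_eq, Nat.mul_eq, Nat.sub_eq, hdiv, Nat.succ_eq_add_one]
  generalize hb : sieveCheck _ _ _ _ _ _ = b
  refine ⟨b, ?_, fun h => h⟩
  cases b <;> rfl

theorem SieveState.Sound.add {s : SieveState} (hs : s.Sound) {c : ℕ} (hc : s.c < c)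
    (hp : c.Prime) (h : ∀ q, q.Prime → s.c < q → ¬ q < c) :
    (sieveAdd c s.n s.p s.l s.t s.lam s.u s.ok).Sound ∧
      (sieveAdd c s.n s.p s.l s.t s.lam s.u s.ok).c = c := by
  obtain ⟨b, hb, hcheck⟩ := sieveAdd_eq c s.n s.p s.l s.t s.lam s.u s.ok
  rw [hb]
  refine ⟨?_, rfl⟩
  have hfil := filter_prime_Ioc_of_prime hc hp h
  have hnot : c ∉ (Ioc 0 s.c).filter Nat.Prime := by
    simp only [mem_filter, mem_Ioc]; omega
  have hple := hs.p_le
  have h31 := hs.le_p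
  have hp0 : (0 : ℝ) < s.p := by exact_mod_cast (by omega : 0 < s.p)
  have hpc : (s.p : ℝ) ≤ c := by exact_mod_cast (by omega : s.p ≤ c)
  have hc2 : (31 : ℝ) ≤ c := by exact_mod_cast (by omega : 31 ≤ c)
  obtain ⟨l, hl⟩ : ∃ l, l = s.l + 2305843009213693952 * (c - s.p) / (c + s.p) := ⟨_, rfl⟩
  obtain ⟨lam, hlam⟩ : ∃ x, x = s.lam + 2305843009213693952 * l / (s.t + (s.t + l)) := ⟨_, rfl⟩
  obtain ⟨u, hu⟩ : ∃ x, x = s.u * c / (c - 1) + 1 := ⟨_, rfl⟩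
  rw [← hl, ← hlam, ← hu] at hcheck ⊢
  have hcard : ((Ioc 0 c).filter Nat.Prime).card = s.n + 1 := by
    rw [hfil, card_insert_of_notMem hnot, hs.card_eq]
  have htheta : Chebyshev.theta c = Chebyshev.theta s.c + Real.log c := by
    rw [theta_natCast, theta_natCast, hfil, sum_insert hnot, add_comm]
  have hl_le : (l : ℝ) ≤ 2 ^ 60 * Real.log c := by
    have h1 := two_mul_sub_div_le_log_sub hp0 hpc
    have h2 : ((2305843009213693952 * (c - s.p) / (c + s.p) : ℕ) : ℝ) ≤
        2 ^ 60 * (2 * (c - s.p) / (c + s.p)) := by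
      refine Nat.cast_div_le.trans (le_of_eq ?_)
      push_cast [Nat.cast_sub (by omega : s.p ≤ c)]
      ring
    rw [hl, Nat.cast_add]
    linarith [hs.l_le]
  have ht_le : ((s.t + l : ℕ) : ℝ) ≤ 2 ^ 60 * Chebyshev.theta c := by
    rw [htheta, Nat.cast_add]; linarith [hs.t_le]
  have ht0 : (0 : ℝ) < s.t := by exact_mod_cast hs.t_pos
  have htl0 : (0 : ℝ) < (s.t + l : ℕ) := by exact_mod_cast (by have := hs.t_pos; omega)
  have hlam_le : (lam : ℝ) ≤ 2 ^ 60 * Real.log ((s.t + l : ℕ) / 2 ^ 60) := by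
    have h1 := two_mul_sub_div_le_log_sub (a := s.t) (b := (s.t + l : ℕ)) ht0 (by simp)
    have h2 : ((2305843009213693952 * l / (s.t + (s.t + l)) : ℕ) : ℝ) ≤
        2 ^ 60 * (2 * ((s.t + l : ℕ) - (s.t : ℝ)) / ((s.t + l : ℕ) + s.t)) := by
      refine Nat.cast_div_le.trans (le_of_eq ?_)
      push_cast
      ring
    have h3 := hs.lam_le
    rw [Real.log_div ht0.ne' (by norm_num)] at h3
    rw [Real.log_div htl0.ne' (by norm_num), hlam, Nat.cast_add (s.lam)]
    generalize ((s.t + l : ℕ) : ℝ) = T at h1 h2 ⊢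
    generalize ((2305843009213693952 * l / (s.t + (s.t + l)) : ℕ) : ℝ) = Q at h2 ⊢
    rw [mul_sub] at h3 ⊢
    linarith
  have hlam_theta : (lam : ℝ) ≤ 2 ^ 60 * Real.log (Chebyshev.theta c) := by
    refine hlam_le.trans ?_
    have h1 : ((s.t + l : ℕ) : ℝ) / 2 ^ 60 ≤ Chebyshev.theta c := by
      rw [div_le_iff₀ (by norm_num)]; linarith
    exact mul_le_mul_of_nonneg_left (Real.log_le_log (by positivity) h1) (by norm_num)
  have hu_le : 2 ^ 60 * primeProd c ≤ u := by
    have h1 : primeProd c = primeProd s.c * (c / (c - 1)) := by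
      unfold primeProd
      rw [hfil, prod_insert hnot, mul_comm]
      congr 1
      have : (c : ℝ) - 1 ≠ 0 := by linarith
      field_simp
    have h2 : (s.u : ℝ) * (c / (c - 1)) ≤ u := by
      have h3 := Nat.lt_mul_div_succ (s.u * c) (by omega : 0 < c - 1)
      rw [← hu] at h3
      have h4 : ((s.u * c : ℕ) : ℝ) < ((c - 1 : ℕ) : ℝ) * u := by exact_mod_cast h3
      rw [← mul_div_assoc, div_le_iff₀ (by linarith)]
      push_cast [Nat.cast_sub (by omega : 1 ≤ c)] at h4
      linarith
    rw [h1, ← mul_assoc]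
    refine le_trans ?_ h2
    have : (0 : ℝ) ≤ c / (c - 1) := div_nonneg (by linarith) (by linarith)
    exact mul_le_mul_of_nonneg_right hs.le_u this
  refine ⟨by dsimp; omega, le_rfl, hcard, hl_le, ?_, ht_le, hlam_le, hu_le, ?_⟩
  · have := hs.t_pos; dsimp; omega
  · intro hbt q hqc hq hn
    obtain ⟨hok, hgood⟩ := sieveCheck_eq_true (hcheck hbt)
    rcases (show q ≤ c from hqc).eq_or_lt with rfl | hlt
    · obtain ⟨h1, h2, h3, h4⟩ := hgood (by omega)
      have h2' : (9451091000000000000 : ℝ) ≤ l := by exact_mod_cast h2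
      have h3' : (9430904000000000000 : ℝ) ≤ lam := by exact_mod_cast h3
      have h4' : (983 : ℝ) * u ≤ 1773 * lam := by exact_mod_cast h4
      refine ⟨h1, by linarith, by linarith, ?_⟩
      have : (2 : ℝ) ^ 60 * (983 * primeProd q) ≤
          2 ^ 60 * (1773 * Real.log (Chebyshev.theta q)) := by linarith
      exact le_of_mul_le_mul_left this (by norm_num)
    · refine hs.good hok q ?_ hq hn
      by_contra h5
      exact h q hq (by omega) hlt

theorem gcd_factorial_eq_one_iff_prime {c M : ℕ} (hM : M < c) (hc : c < (M + 1) ^ 2)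
    (hc2 : 2 ≤ c) : Nat.gcd c M.factorial = 1 ↔ c.Prime := by
  rw [← Nat.coprime_iff_gcd_eq_one, Nat.coprime_factorial_iff (by omega)]
  constructor
  · intro h
    by_contra hp
    have h1 := Nat.minFac_sq_le_self (by omega) hp
    have : (M + 1) ^ 2 ≤ c.minFac ^ 2 := Nat.pow_le_pow_left (by omega) 2
    omega
  · intro hp
    rwa [hp.minFac_eq]

theorem SieveState.Sound.step {s : SieveState} (hs : s.Sound) {M d : ℕ} (hd : 0 < d)
    (hM : M ≤ s.c) (hlt : s.c + d < (M + 1) ^ 2)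
    (h : ∀ q, q.Prime → s.c < q → ¬ q < s.c + d) :
    (sieveStep M.factorial d s).Sound ∧ (sieveStep M.factorial d s).c = s.c + d := by
  have hc31 : 31 ≤ s.c := hs.le_p.trans hs.p_le
  have hiff := gcd_factorial_eq_one_iff_prime (by omega : M < s.c + d) hlt (by omega)
  have heq : sieveStep M.factorial d s =
      branch (Nat.beq (Nat.gcd (s.c + d) M.factorial) 1)
        (sieveAdd (s.c + d) s.n s.p s.l s.t s.lam s.u s.ok)
        ⟨s.c + d, s.n, s.p, s.l, s.t, s.lam, s.u, s.ok⟩ := by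
    cases s
    simp only [sieveStep, force_eq, Nat.add_eq]
  rw [heq]
  rcases hb : Nat.beq (Nat.gcd (s.c + d) M.factorial) 1 with _ | _
  · rw [branch_false]
    refine ⟨?_, rfl⟩
    have hnp : ¬ (s.c + d).Prime := by
      rw [← hiff]; exact Nat.ne_of_beq_eq_false hb
    have hno : ∀ q, q.Prime → s.c < q → ¬ q ≤ s.c + d := by
      intro q hq h1 h2
      rcases h2.eq_or_lt with rfl | h2
      · exact hnp hq
      · exact h q hq h1 h2
    have hfil := filter_prime_Ioc_of_not_prime (by omega : s.c ≤ s.c + d) hno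
    have hθ : Chebyshev.theta (s.c + d : ℕ) = Chebyshev.theta s.c := by
      rw [theta_natCast, theta_natCast, hfil]
    have hP : primeProd (s.c + d) = primeProd s.c := by
      unfold primeProd; rw [hfil]
    refine ⟨hs.le_p, hs.p_le.trans (Nat.le_add_right _ _), ?_, hs.l_le, hs.t_pos, ?_, hs.lam_le,
      ?_, ?_⟩
    · dsimp only; rw [hfil, hs.card_eq]
    · dsimp only; rw [hθ]; exact hs.t_le
    · dsimp only; rw [hP]; exact hs.le_u
    · intro hok q hqc hq hn
      refine hs.good hok q ?_ hq hn
      by_contra h1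
      exact hno q hq (by omega) hqc
  · rw [branch_true]
    exact hs.add (by omega) (hiff.1 (Nat.eq_of_beq_eq_true hb)) h

theorem SieveState.Sound.step_step {s : SieveState} (hs : s.Sound) {M : ℕ} (hmod : s.c % 6 = 1)
    (hM : M ≤ s.c) (hlt : s.c + 6 < (M + 1) ^ 2) :
    (sieveStep M.factorial 2 (sieveStep M.factorial 4 s)).Sound ∧
      (sieveStep M.factorial 2 (sieveStep M.factorial 4 s)).c = s.c + 6 := by
  have hc31 : 31 ≤ s.c := hs.le_p.trans hs.p_le
  have hmod6 : ∀ q, q.Prime → s.c < q → q % 2 ≠ 0 ∧ q % 3 ≠ 0 := by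
    intro q hq hlt
    refine ⟨fun h => ?_, fun h => ?_⟩
    · have := (Nat.prime_dvd_prime_iff_eq Nat.prime_two hq).1 (Nat.dvd_of_mod_eq_zero h)
      omega
    · have := (Nat.prime_dvd_prime_iff_eq Nat.prime_three hq).1 (Nat.dvd_of_mod_eq_zero h)
      omega
  obtain ⟨h1, h2⟩ := hs.step (d := 4) (by norm_num) hM (by omega) fun q hq ha hb => by
    have := hmod6 q hq ha
    omega
  obtain ⟨h3, h4⟩ := h1.step (d := 2) (M := M) (by norm_num) (by omega) (by omega)
    fun q hq ha hb => by
      have := hmod6 q hq (by omega)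
      omega
  exact ⟨h3, by omega⟩

theorem SieveState.Sound.iter {M k : ℕ} : ∀ {s : SieveState}, s.Sound → s.c % 6 = 1 → M ≤ s.c →
    s.c + 6 * 2 ^ k < (M + 1) ^ 2 →
    (iterTwoPow (fun s => sieveStep M.factorial 2 (sieveStep M.factorial 4 s)) k s).Sound ∧
      (iterTwoPow (fun s => sieveStep M.factorial 2 (sieveStep M.factorial 4 s)) k s).c =
        s.c + 6 * 2 ^ k := by
  induction k with
  | zero => intro s hs hmod hM hlt; exact hs.step_step hmod hM (by omega)
  | succ k ih =>
    intro s hs hmod hM hlt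
    have heq : iterTwoPow (fun s => sieveStep M.factorial 2 (sieveStep M.factorial 4 s)) (k + 1) s =
        iterTwoPow (fun s => sieveStep M.factorial 2 (sieveStep M.factorial 4 s)) k
          (iterTwoPow (fun s => sieveStep M.factorial 2 (sieveStep M.factorial 4 s)) k s) :=
      forceState_eq _ _
    rw [heq]
    rw [pow_succ] at hlt
    obtain ⟨h1, h2⟩ := ih hs hmod hM (by omega)
    obtain ⟨h3, h4⟩ := ih h1 (by omega) (by omega) (by omega)
    exact ⟨h3, by rw [h4, h2, pow_succ]; omega⟩

theorem SieveState.eq_of_eqOk {s r : SieveState} (h : s.eqOk r = true) (hr : r.ok = true) :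
    s = r := by
  obtain ⟨c, n, p, l, t, lam, u, ok⟩ := s
  obtain ⟨c', n', p', l', t', lam', u', ok'⟩ := r
  simp only [SieveState.eqOk] at h
  cases ok with
  | false => simp at h
  | true =>
    rw [branch_true] at h
    rcases h1 : Nat.beq c c' with _ | _
    · simp [h1] at h
    rcases h2 : Nat.beq n n' with _ | _
    · simp [h1, h2] at h
    rcases h3 : Nat.beq p p' with _ | _
    · simp [h1, h2, h3] at h
    rcases h4 : Nat.beq l l' with _ | _
    · simp [h1, h2, h3, h4] at h
    rcases h5 : Nat.beq t t' with _ | _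
    · simp [h1, h2, h3, h4, h5] at h
    rcases h6 : Nat.beq lam lam' with _ | _
    · simp [h1, h2, h3, h4, h5, h6] at h
    rw [h1, h2, h3, h4, h5, h6] at h
    simp only [branch_true] at h
    rw [Nat.eq_of_beq_eq_true h1, Nat.eq_of_beq_eq_true h2, Nat.eq_of_beq_eq_true h3,
      Nat.eq_of_beq_eq_true h4, Nat.eq_of_beq_eq_true h5, Nat.eq_of_beq_eq_true h6,
      Nat.eq_of_beq_eq_true h, show ok' = true from hr]

theorem SieveState.Sound.of_run {M k : ℕ} {s r : SieveState} (hs : s.Sound) (hmod : s.c % 6 = 1)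
    (hM : M ≤ s.c) (hlt : s.c + 6 * 2 ^ k < (M + 1) ^ 2) (hr : r.ok = true)
    (h : (sieveRun M k s).eqOk r = true) : r.Sound := by
  have h1 := (hs.iter (k := k) hmod hM hlt).1
  have h2 : sieveRun M k s =
      iterTwoPow (fun s => sieveStep M.factorial 2 (sieveStep M.factorial 4 s)) k s := by
    simp only [sieveRun, force_eq]
  rw [← h2, SieveState.eq_of_eqOk h hr] at h1
  exact h1

theorem filter_prime_Ioc_31 :
    (Ioc 0 31).filter Nat.Prime = {2, 3, 5, 7, 11, 13, 17, 19, 23, 29, 31} := by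
  decide +kernel

theorem sieveState31_l_le : (3959116541674170499 : ℝ) ≤ 2 ^ 60 * Real.log 31 := by
  have h2 := Real.log_two_gt_d9
  have h3 := Real.log_three_gt_d9
  have h5 := Real.log_five_gt_d9
  have h := two_mul_sub_div_le_log_sub (a := 2 ^ 6 * 3 * 5) (b := 31 ^ 2) (by norm_num)
    (by norm_num)
  rw [Real.log_mul (by norm_num) (by norm_num), Real.log_mul (by norm_num) (by norm_num),
    Real.log_pow, Real.log_pow] at h
  norm_num at h
  linarith

theorem sieveState31_t_le :
    (30004068192997398768 : ℝ) ≤ 2 ^ 60 * Real.log 200560490130 := by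
  have h2 := Real.log_two_lt_d9
  have h3 := Real.log_three_gt_d9
  have h5 := Real.log_five_gt_d9
  have h := two_mul_sub_div_le_log_sub (a := 3 ^ 8 * 5 ^ 12 / 2 ^ 3) (b := 200560490130)
    (by norm_num) (by norm_num)
  rw [Real.log_div (by norm_num) (by norm_num), Real.log_mul (by norm_num) (by norm_num),
    Real.log_pow, Real.log_pow, Real.log_pow] at h
  norm_num at h
  linarith

theorem sieveState31_lam_le :
    (3757409021472604015 : ℝ) ≤ 2 ^ 60 * Real.log (30004068192997398768 / 2 ^ 60) := by
  have h2 := Real.log_two_gt_d9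
  have h3 := Real.log_three_lt_d9
  have h5 := Real.log_five_gt_d9
  have h := two_mul_sub_div_le_log_sub (a := 2 ^ 12 * 5 ^ 3 / 3 ^ 9)
    (b := 30004068192997398768 / 2 ^ 60) (by norm_num) (by norm_num)
  rw [Real.log_div (x := 2 ^ 12 * 5 ^ 3) (by norm_num) (by norm_num),
    Real.log_mul (by norm_num) (by norm_num), Real.log_pow, Real.log_pow, Real.log_pow] at h
  generalize Real.log (30004068192997398768 / 2 ^ 60) = X at h ⊢
  norm_num at h ⊢
  linarith

theorem sieveState31_sound : sieveState31.Sound where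
  le_p := le_rfl
  p_le := le_rfl
  card_eq := by
    show ((Ioc 0 31).filter Nat.Prime).card = 11
    rw [filter_prime_Ioc_31]; decide
  l_le := by
    have := sieveState31_l_le
    simpa [sieveState31] using this
  t_pos := by simp [sieveState31]
  t_le := by
    have hθ : Chebyshev.theta ((31 : ℕ) : ℝ) = Real.log 200560490130 := by
      rw [theta_natCast, filter_prime_Ioc_31, ← Real.log_prod]
      · congr 1
        norm_num
      · intro p hp
        have : p ≠ 0 := by rintro rfl; simp at hp
        exact_mod_cast this
    show ((30004068192997398768 : ℕ) : ℝ) ≤ 2 ^ 60 * Chebyshev.theta ((31 : ℕ) : ℝ)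
    rw [hθ]
    exact_mod_cast sieveState31_t_le
  lam_le := by
    have := sieveState31_lam_le
    simpa [sieveState31] using this
  le_u := by
    show 2 ^ 60 * primeProd 31 ≤ ((7542723436537264518 : ℕ) : ℝ)
    rw [primeProd, filter_prime_Ioc_31]
    norm_num
  good := by
    intro _ q hq _ hcard
    have h1 := card_filter_le (Ioc 0 q) Nat.Prime
    rw [Nat.card_Ioc] at h1
    have : q ≤ 31 := hq
    omega

theorem sieveState394015_sound : sieveState394015.Sound := by
  have h := sieveState31_sound
  replace h := h.of_run rfl le_rfl (by norm_num [sieveState31]) rfl sieveRun_state31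
  replace h := h.of_run rfl (by norm_num [sieveState799]) (by norm_num [sieveState799]) rfl
    sieveRun_state799
  replace h := h.of_run rfl (by norm_num [sieveState49951]) (by norm_num [sieveState49951]) rfl
    sieveRun_state49951
  replace h := h.of_run rfl (by norm_num [sieveState99103]) (by norm_num [sieveState99103]) rfl
    sieveRun_state99103
  replace h := h.of_run rfl (by norm_num [sieveState148255]) (by norm_num [sieveState148255]) rfl
    sieveRun_state148255
  replace h := h.of_run rfl (by norm_num [sieveState197407]) (by norm_num [sieveState197407]) rfl
    sieveRun_state197407
  replace h := h.of_run rfl (by norm_num [sieveState246559]) (by norm_num [sieveState246559]) rfl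
    sieveRun_state246559
  replace h := h.of_run rfl (by norm_num [sieveState295711]) (by norm_num [sieveState295711]) rfl
    sieveRun_state295711
  exact h.of_run rfl (by norm_num [sieveState344863]) (by norm_num [sieveState344863]) rfl
    sieveRun_state344863

theorem sieveGood_of_le {q : ℕ} (hq : q ≤ 394015) (hp : q.Prime)
    (hcard : 509 ≤ ((Ioc 0 q).filter Nat.Prime).card) : SieveGood q :=
  sieveState394015_sound.good rfl q hq hp hcard

theorem card_filter_prime_Ioc_394015 : ((Ioc 0 394015).filter Nat.Prime).card = 33401 :=
  sieveState394015_sound.card_eq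

theorem filter_prime_Ioc_nthPrime {n : ℕ} (hn : 0 < n) :
    (Ioc 0 (nthPrime n)).filter Nat.Prime = (range n).image (Nat.nth Nat.Prime) := by
  ext q
  simp only [mem_filter, mem_Ioc, mem_image, mem_range, nthPrime]
  constructor
  · rintro ⟨⟨_, h2⟩, h3⟩
    obtain ⟨k, rfl⟩ : q ∈ Set.range (Nat.nth Nat.Prime) := by
      rw [Nat.range_nth_of_infinite Nat.infinite_setOfPred_prime]; exact h3
    have := (Nat.nth_le_nth Nat.infinite_setOfPred_prime).1 h2
    exact ⟨k, by omega, rfl⟩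
  · rintro ⟨k, hk, rfl⟩
    have h3 := Nat.nth_mem_of_infinite Nat.infinite_setOfPred_prime k
    exact ⟨⟨Nat.Prime.pos h3, (Nat.nth_le_nth Nat.infinite_setOfPred_prime).2 (by omega)⟩, h3⟩

theorem card_filter_prime_Ioc_nthPrime {n : ℕ} (hn : 0 < n) :
    ((Ioc 0 (nthPrime n)).filter Nat.Prime).card = n := by
  rw [filter_prime_Ioc_nthPrime hn,
    card_image_of_injective _ (Nat.nth_injective Nat.infinite_setOfPred_prime), card_range]

theorem primorialAt_eq_prod {n : ℕ} (hn : 0 < n) :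
    primorialAt n = ∏ p ∈ Ioc 0 (nthPrime n) with p.Prime, p := by
  rw [filter_prime_Ioc_nthPrime hn,
    prod_image (Nat.nth_injective Nat.infinite_setOfPred_prime).injOn, primorialAt]

theorem log_primorialAt {n : ℕ} (hn : 0 < n) :
    Real.log (primorialAt n) = Chebyshev.theta (nthPrime n) := by
  rw [primorialAt_eq_prod hn, theta_natCast, Nat.cast_prod, Real.log_prod]
  intro p hp
  exact_mod_cast (mem_filter.1 hp).2.ne_zero

theorem primeFactors_primorialAt {n : ℕ} (hn : 0 < n) :
    (primorialAt n).primeFactors = (Ioc 0 (nthPrime n)).filter Nat.Prime := by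
  rw [primorialAt_eq_prod hn]
  exact Nat.primeFactors_prod fun p hp => (mem_filter.1 hp).2

theorem prod_one_sub_pow_neg_six_le {q : ℕ} (hq : 5 ≤ q) :
    ∏ p ∈ Ioc 0 q with p.Prime, (1 - ((p : ℝ)⁻¹) ^ 6) ≤ 0.983 := by
  have hsub : ({2, 3, 5} : Finset ℕ) ⊆ (Ioc 0 q).filter Nat.Prime := by
    intro p hp
    simp only [mem_insert, mem_singleton] at hp
    simp only [mem_filter, mem_Ioc]
    rcases hp with rfl | rfl | rfl <;> exact ⟨by omega, by norm_num⟩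
  rw [← prod_sdiff hsub]
  have h1 : ∏ p ∈ (Ioc 0 q).filter Nat.Prime \ {2, 3, 5}, (1 - ((p : ℝ)⁻¹) ^ 6) ≤ 1 := by
    refine prod_le_one (fun p _ => ?_) (fun p _ => ?_)
    · have : ((p : ℝ)⁻¹) ^ 6 ≤ 1 := pow_le_one₀ (by positivity) (Nat.cast_inv_le_one p)
      linarith
    · have : 0 ≤ ((p : ℝ)⁻¹) ^ 6 := by positivity
      linarith
  have h2 : ∏ p ∈ ({2, 3, 5} : Finset ℕ), (1 - ((p : ℝ)⁻¹) ^ 6) =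
      63 / 64 * (728 / 729) * (15624 / 15625) := by
    norm_num
  rw [h2]
  refine (mul_le_mul_of_nonneg_right h1 (by norm_num)).trans ?_
  norm_num

theorem primeProd_nonneg (q : ℕ) : 0 ≤ primeProd q := by
  refine prod_nonneg fun p _ => inv_nonneg.2 ?_
  have := Nat.cast_inv_le_one (α := ℝ) p
  linarith

theorem Rt_six_primorialAt_le {n : ℕ} (hn : 509 ≤ n)
    (hθ : 0 < Real.log (Chebyshev.theta (nthPrime n))) :
    Rt 6 (primorialAt n) ≤
      0.983 * primeProd (nthPrime n) / Real.log (Chebyshev.theta (nthPrime n)) := by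
  have hn0 : 0 < n := by omega
  have hq : 5 ≤ nthPrime n := by
    have h1 := card_filter_le (Ioc 0 (nthPrime n)) Nat.Prime
    rw [Nat.card_Ioc, card_filter_prime_Ioc_nthPrime hn0] at h1
    omega
  have hN : (primorialAt n : ℝ) ≠ 0 := by
    rw [primorialAt_eq_prod hn0]
    exact Nat.cast_ne_zero.2 (prod_ne_zero_iff.2 fun p hp => (mem_filter.1 hp).2.ne_zero)
  have hsum : ∏ p ∈ (primorialAt n).primeFactors, ∑ i ∈ range 6, (1 : ℝ) / (p : ℝ) ^ i =
      (∏ p ∈ Ioc 0 (nthPrime n) with p.Prime, (1 - ((p : ℝ)⁻¹) ^ 6)) * primeProd (nthPrime n) := by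
    rw [primeFactors_primorialAt hn0, primeProd, ← prod_mul_distrib]
    refine prod_congr rfl fun p hp => ?_
    have hp1 : (1 : ℝ) < p := by exact_mod_cast (mem_filter.1 hp).2.one_lt
    have hinv : (p : ℝ)⁻¹ ≠ 1 := (inv_lt_one_of_one_lt₀ hp1).ne
    have h1 : ∑ i ∈ range 6, (1 : ℝ) / (p : ℝ) ^ i = ∑ i ∈ range 6, ((p : ℝ)⁻¹) ^ i :=
      sum_congr rfl fun i _ => by rw [inv_pow, one_div]
    rw [h1, geom_sum_eq hinv, ← neg_div_neg_eq, neg_sub, neg_sub, div_eq_mul_inv]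
  rw [Rt, Psi, hsum, log_primorialAt hn0, mul_div_mul_left _ _ hN]
  gcongr
  · exact primeProd_nonneg _
  · exact prod_one_sub_pow_neg_six_le hq

theorem lt_exp_eulerMascheroniConstant : 1.773 < Real.exp Real.eulerMascheroniConstant := by
  have h1 : (0.573 : ℝ) < Real.eulerMascheroniConstant := by
    refine lt_trans ?_ (Real.eulerMascheroniSeq_lt_eulerMascheroniConstant 127)
    have h2 : Real.log ((127 : ℕ) + 1 : ℝ) = 7 * Real.log 2 := by
      rw [show (((127 : ℕ) : ℝ) + 1) = 2 ^ 7 by norm_num, Real.log_pow]; norm_num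
    have h3 : (5.4253 : ℚ) < harmonic 127 := by decide +kernel
    have h4 : (5.4253 : ℝ) < (harmonic 127 : ℚ) := by
      have : ((5.4253 : ℚ) : ℝ) < (harmonic 127 : ℚ) := by exact_mod_cast h3
      norm_num at this ⊢
    rw [Real.eulerMascheroniSeq, h2]
    linarith [Real.log_two_lt_d9]
  refine lt_trans ?_ (Real.exp_lt_exp.2 h1)
  refine lt_of_lt_of_le ?_ (Real.sum_le_exp_of_nonneg (by norm_num) 6)
  norm_num [Finset.sum_range_succ, Nat.factorial]

theorem lt_zetaNat_six : 1.0173427 < zetaNat 6 := by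
  have hs : Summable (fun k : ℕ => 1 / ((k : ℝ) + 1) ^ 6) := by
    have := (summable_nat_add_iff 1).2 (Real.summable_one_div_nat_pow.2 (by norm_num : 1 < 6))
    simpa using this
  refine lt_of_lt_of_le ?_ (hs.sum_le_tsum (range 15) fun k _ => by positivity)
  norm_num [Finset.sum_range_succ]

theorem sieveGood_nthPrime {n : ℕ} (hn : 509 ≤ n) (hq : nthPrime n ≤ 394015) :
    SieveGood (nthPrime n) :=
  sieveGood_of_le hq (Nat.nth_mem_of_infinite Nat.infinite_setOfPred_prime _)
    (by rwa [card_filter_prime_Ioc_nthPrime (by omega)])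

theorem sieveGood_nthPrime_509 : SieveGood (nthPrime 509) := by
  refine sieveGood_nthPrime le_rfl ?_
  by_contra h
  have h1 : (Ioc 0 394015).filter Nat.Prime ⊆ (Ioc 0 (nthPrime 509)).filter Nat.Prime :=
    filter_subset_filter _ (Ioc_subset_Ioc_right (by omega))
  have h2 := card_le_card h1
  rw [card_filter_prime_Ioc_394015, card_filter_prime_Ioc_nthPrime (by norm_num)] at h2
  omega

theorem R6_primorial_lt_exp_gamma (n : ℕ) (hn : 509 ≤ n) :
    Real.exp (2 / (nthPrime n : ℝ)) *
        (1 + 1.1253 / (Real.log (nthPrime n) * Real.log (Real.log (primorialAt n)))) <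
      zetaNat 6 ∧
    Rt 6 (primorialAt n) < Real.exp Real.eulerMascheroniConstant := by
  have hgood := sieveGood_nthPrime_509
  have hmono : nthPrime 509 ≤ nthPrime n :=
    (Nat.nth_le_nth Nat.infinite_setOfPred_prime).2 (by omega)
  obtain ⟨q, hq⟩ : ∃ q, q = nthPrime n := ⟨_, rfl⟩
  have h3637 : (3637 : ℝ) ≤ q := by exact_mod_cast hgood.le_self.trans (hq ▸ hmono)
  have hle : ((nthPrime 509 : ℕ) : ℝ) ≤ q := by exact_mod_cast hq ▸ hmono
  have hpos509 : (0 : ℝ) < nthPrime 509 := by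
    exact_mod_cast lt_of_lt_of_le (by norm_num) hgood.le_self
  have hlogq : 8.1975147 ≤ Real.log q := by
    have := hgood.le_log
    have := Real.log_le_log hpos509 hle
    linarith
  have hlogθ : 8.1800052 ≤ Real.log (Chebyshev.theta q) := by
    have h1 := hgood.le_log_theta
    have hθpos : 0 < Chebyshev.theta (nthPrime 509) :=
      Chebyshev.theta_pos (by have := hgood.le_self; exact_mod_cast (by omega : 2 ≤ nthPrime 509))
    have h2 := Real.log_le_log hθpos (Chebyshev.theta_mono hle)
    linarith
  constructor
  · rw [log_primorialAt (by omega), ← hq]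
    refine lt_trans ?_ lt_zetaNat_six
    have hq0 : (0 : ℝ) < q := by linarith
    have hx : 2 / (q : ℝ) ≤ 2 / 3637 := by gcongr
    have hexp : Real.exp (2 / (q : ℝ)) ≤ 3637 / 3635 := by
      have h1 := Real.add_one_le_exp (-(2 / (q : ℝ)))
      have h2 : (3635 / 3637 : ℝ) ≤ Real.exp (-(2 / (q : ℝ))) := by linarith
      rw [Real.exp_neg] at h2
      have h3 := inv_anti₀ (by norm_num) h2
      rw [inv_inv] at h3
      norm_num at h3 ⊢
      exact h3
    have hfrac : 1.1253 / (Real.log q * Real.log (Chebyshev.theta q)) ≤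
        1.1253 / (8.1975147 * 8.1800052) := by gcongr
    calc Real.exp (2 / (q : ℝ)) * (1 + 1.1253 / (Real.log q * Real.log (Chebyshev.theta q)))
        ≤ 3637 / 3635 * (1 + 1.1253 / (8.1975147 * 8.1800052)) := by
          gcongr
      _ < 1.0173427 := by norm_num
  · have hθ0 : 0 < Real.log (Chebyshev.theta q) := by linarith
    have hR := Rt_six_primorialAt_le hn (by rwa [← hq])
    rw [← hq] at hR
    refine lt_of_le_of_lt hR ?_
    rw [div_lt_iff₀ hθ0]
    rcases le_or_gt q 394015 with hsmall | hlarge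
    · have h1 := (sieveGood_nthPrime hn (hq ▸ hsmall)).prod_le
      rw [← hq] at h1
      have h2 := mul_lt_mul_of_pos_right lt_exp_eulerMascheroniConstant hθ0
      linarith
    · have h1 := sum_neg_log_one_sub_inv_lt (N := q) hlarge
      have hpos : ∀ p ∈ (Ioc 0 q).filter Nat.Prime, (0 : ℝ) < (1 - (p : ℝ)⁻¹)⁻¹ := by
        intro p hp
        have hp1 : (1 : ℝ) < p := by exact_mod_cast (mem_filter.1 hp).2.one_lt
        exact inv_pos.2 (by linarith [inv_lt_one_of_one_lt₀ hp1])
      have h2 : ∑ p ∈ Ioc 0 q with p.Prime, -Real.log (1 - (p : ℝ)⁻¹) =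
          Real.log (primeProd q) := by
        rw [primeProd, Real.log_prod fun p hp => (hpos p hp).ne']
        exact sum_congr rfl fun p _ => (Real.log_inv _).symm
      have hP : 0 < primeProd q := prod_pos hpos
      have h3 := two_mul_sub_div_le_log_sub (a := 0.983) (b := 1) (by norm_num) (by norm_num)
      rw [Real.log_one] at h3
      norm_num at h3
      rw [← Real.log_lt_log_iff (by positivity) (by positivity),
        Real.log_mul (by norm_num) hP.ne', Real.log_mul (Real.exp_pos _).ne' hθ0.ne',
        Real.log_exp, ← h2]
      norm_num at h1 ⊢
      linarith
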